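/- Let n ≥ 1, let Ω ⊂ ℍⁿ be a bounded open set, and let Σ be a non-empty open subset of S^{2n×2n} satisfying: (i) A ∈ Σ, B ∈ S^{2n×2n}, B positive definite imply A + B ∈ Σ; (ii) A ∈ Σ and c > 0 imply cA ∈ Σ. Let F[ψ] = ∇²_{H,s}ψ + L(·, ψ, ∇_H ψ) where L(ξ,s,p) = α(ξ,s) p⊗p − γ(ξ,s) Jp⊗Jp − β(ξ,s)|p|² I₂ₙ with α, β, γ ∈ C^{0,1}_loc(Ω̄ × ℝ), L(ξ,s,p) is non-decreasing in s (as a symmetric matrix), and either β(ξ,s) > β₀ > 0 for some constant β₀ and γ ≥ 0, or β(ξ,s) < −β₀ < 0 for some constant β₀ and γ ≤ 0, or α and β are constant and γ ≡ 0. If w ∈ LSC(Ω̄) is a viscosity supersolution and v ∈ USC(Ω̄) is a viscosity subsolution of F[ψ] ∈ ∂Σ in Ω, and if w ≥ v in Ω and w > v on ∂Ω, then w > v in Ω. -/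

import Mathlib

open Filter Topology Matrix Asymptotics

noncomputable section

/-- Points of the Heisenberg group `ℍⁿ`: `(x, y, t) ∈ ℝⁿ × ℝⁿ × ℝ`. -/
abbrev Heis (n : ℕ) : Type := (Fin n → ℝ) × (Fin n → ℝ) × ℝ

/-- Index type for the `2n` horizontal directions. -/
abbrev HIdx (n : ℕ) : Type := Fin n ⊕ Fin n

/-- `2n × 2n` real matrices. -/
abbrev HMat (n : ℕ) : Type := Matrix (HIdx n) (HIdx n) ℝ

namespace Heis

variable {n : ℕ}

/-- The Heisenberg group law. -/
def hmul (ξ η : Heis n) : Heis n :=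
  (ξ.1 + η.1, ξ.2.1 + η.2.1,
    ξ.2.2 + η.2.2 + 2 * ∑ i, (ξ.2.1 i * η.1 i - ξ.1 i * η.2.1 i))

/-- The group inverse `ξ⁻¹ = -ξ`. -/
def hinv (ξ : Heis n) : Heis n := (-ξ.1, -ξ.2.1, -ξ.2.2)

/-- `|z|²` for `ξ = (z, t)`. -/
def zsq (ξ : Heis n) : ℝ := ∑ i, (ξ.1 i ^ 2 + ξ.2.1 i ^ 2)

/-- The homogeneous norm `|ξ|_H = (|z|⁴ + t²)^{1/4}`. -/
def hnorm (ξ : Heis n) : ℝ := (zsq ξ ^ 2 + ξ.2.2 ^ 2) ^ ((1 : ℝ) / 4)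

/-- The left-invariant horizontal vector fields `X_j` (for `Sum.inl j`)
and `Y_j` (for `Sum.inr j`), as tangent vectors at `ξ`. -/
def vecField (j : HIdx n) (ξ : Heis n) : Heis n :=
  match j with
  | Sum.inl j => (Pi.single j 1, 0, 2 * ξ.2.1 j)
  | Sum.inr j => (0, Pi.single j 1, -(2 * ξ.1 j))

/-- Horizontal (Heisenberg) gradient `∇_H ψ (ξ) ∈ ℝ^{2n}`. -/
def hGrad (ψ : Heis n → ℝ) (ξ : Heis n) : HIdx n → ℝ :=
  fun j => fderiv ℝ ψ ξ (vecField j ξ)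

/-- Heisenberg Hessian: entry `(i, j)` is `(field j)((field i) ψ)(ξ)`. -/
def hHess (ψ : Heis n → ℝ) (ξ : Heis n) : HMat n :=
  Matrix.of fun i j =>
    fderiv ℝ (fun η => fderiv ℝ ψ η (vecField i η)) ξ (vecField j ξ)

/-- Symmetrized Heisenberg Hessian `∇²_{H,s} ψ`. -/
def hHessSym (ψ : Heis n → ℝ) (ξ : Heis n) : HMat n :=
  ((1 : ℝ) / 2) • (hHess ψ ξ + (hHess ψ ξ)ᵀ)

/-- The standard symplectic matrix `J = [[0, Iₙ], [-Iₙ, 0]]`. -/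
def Jmat (n : ℕ) : HMat n :=
  Matrix.of fun i j =>
    match i, j with
    | Sum.inl a, Sum.inr b => if a = b then (1 : ℝ) else 0
    | Sum.inr a, Sum.inl b => if a = b then (-1 : ℝ) else 0
    | _, _ => 0

/-- Euclidean norm of `p ∈ ℝ^{2n}`. -/
def pnorm (p : HIdx n → ℝ) : ℝ := Real.sqrt (∑ j, p j ^ 2)

/-- The Loewner (positive semidefinite) order on matrices. -/
def matLE (A B : HMat n) : Prop := (B - A).PosSemidef

/-- The operator `F[ψ] = ∇²_{H,s} ψ + L(·, ψ, ∇_H ψ)`. -/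
def Fop (L : Heis n → ℝ → (HIdx n → ℝ) → HMat n) (ψ : Heis n → ℝ) (ξ : Heis n) : HMat n :=
  hHessSym ψ ξ + L ξ (ψ ξ) (hGrad ψ ξ)

/-- Viscosity subsolution of `F[ψ] ∈ ∂Σ` in `Ω`: `F[ψ] ∈ closure Σ`
in the viscosity sense. -/
def IsSubsolution (Ω : Set (Heis n)) (L : Heis n → ℝ → (HIdx n → ℝ) → HMat n)
    (S : Set (HMat n)) (v : Heis n → EReal) : Prop :=
  ∀ ξ₀ ∈ Ω, ∀ φ : Heis n → ℝ, ContDiffOn ℝ 2 φ Ω → v ξ₀ = ((φ ξ₀ : ℝ) : EReal) →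
    (∀ᶠ η in nhds ξ₀, η ∈ Ω → v η ≤ ((φ η : ℝ) : EReal)) →
    Fop L φ ξ₀ ∈ closure S

/-- Viscosity supersolution of `F[ψ] ∈ ∂Σ` in `Ω`: `F[ψ] ∈ S^{2n×2n} ∖ Σ`
in the viscosity sense. -/
def IsSupersolution (Ω : Set (Heis n)) (L : Heis n → ℝ → (HIdx n → ℝ) → HMat n)
    (S : Set (HMat n)) (w : Heis n → EReal) : Prop :=
  ∀ ξ₀ ∈ Ω, ∀ φ : Heis n → ℝ, ContDiffOn ℝ 2 φ Ω → w ξ₀ = ((φ ξ₀ : ℝ) : EReal) →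
    (∀ᶠ η in nhds ξ₀, η ∈ Ω → ((φ η : ℝ) : EReal) ≤ w η) →
    Fop L φ ξ₀ ∉ S

/-- The class `USC(s)`: upper semicontinuous, valued in `ℝ ∪ {-∞}`, not identically `-∞`. -/
def USCFun (s : Set (Heis n)) (v : Heis n → EReal) : Prop :=
  UpperSemicontinuousOn v s ∧ (∀ ξ ∈ s, v ξ ≠ ⊤) ∧ (∃ ξ ∈ s, v ξ ≠ ⊥)

/-- The class `LSC(s)`: lower semicontinuous, valued in `ℝ ∪ {+∞}`, not identically `+∞`. -/
def LSCFun (s : Set (Heis n)) (w : Heis n → EReal) : Prop :=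
  LowerSemicontinuousOn w s ∧ (∀ ξ ∈ s, w ξ ≠ ⊥) ∧ (∃ ξ ∈ s, w ξ ≠ ⊤)

/-- `Σ` is (relatively) open as a subset of the space of symmetric matrices. -/
def RelOpen (S : Set (HMat n)) : Prop :=
  IsOpen {A : {M : HMat n // M.IsSymm} | A.1 ∈ S}

/-- The quadratic lower-order term
`L(ξ,s,p) = α(ξ,s) p⊗p - γ(ξ,s) Jp⊗Jp - β(ξ,s)|p|² I₂ₙ`. -/
def Lquad (α β γ : Heis n → ℝ → ℝ) : Heis n → ℝ → (HIdx n → ℝ) → HMat n :=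
  fun ξ s p =>
    α ξ s • vecMulVec p p - γ ξ s • vecMulVec (Jmat n *ᵥ p) (Jmat n *ᵥ p)
      - (β ξ s * ∑ j, p j ^ 2) • (1 : HMat n)

/-- The quadratic lower-order term with constant coefficients
`L(s,p) = a p⊗p - c Jp⊗Jp - b|p|² I₂ₙ`. -/
def LquadC (a b c : ℝ) : Heis n → ℝ → (HIdx n → ℝ) → HMat n :=
  fun _ _ p =>
    a • vecMulVec p p - c • vecMulVec (Jmat n *ᵥ p) (Jmat n *ᵥ p)
      - (b * ∑ j, p j ^ 2) • (1 : HMat n)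

/-- Locally Lipschitz on a set. -/
def LocallyLipschitzOnSet {X : Type*} [PseudoMetricSpace X] (s : Set X) (f : X → ℝ) : Prop :=
  ∀ x ∈ s, ∃ K : NNReal, ∃ t ∈ nhdsWithin x s, LipschitzOnWith K f t

/-- All entries of `L(ξ,s,·)` are differentiable at `p`. -/
def DiffInP (L : Heis n → ℝ → (HIdx n → ℝ) → HMat n) (ξ : Heis n) (s : ℝ)
    (p : HIdx n → ℝ) : Prop :=
  ∀ i j, DifferentiableAt ℝ (fun q => L ξ s q i j) p

/-- All entries of `L(·,s,p)` are differentiable at `ξ`. -/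
def DiffInXi (L : Heis n → ℝ → (HIdx n → ℝ) → HMat n) (ξ : Heis n) (s : ℝ)
    (p : HIdx n → ℝ) : Prop :=
  ∀ i j, DifferentiableAt ℝ (fun η => L η s p i j) ξ

/-- A norm of `∇_p L(ξ,s,p)`. -/
def pGradNorm (L : Heis n → ℝ → (HIdx n → ℝ) → HMat n) (ξ : Heis n) (s : ℝ)
    (p : HIdx n → ℝ) : ℝ :=
  Real.sqrt (∑ i, ∑ j, ∑ k, (fderiv ℝ (fun q => L ξ s q i j) p (Pi.single k 1)) ^ 2)

/-- A norm of `∇_ξ L(ξ,s,p)`. -/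
def xiGradNorm (L : Heis n → ℝ → (HIdx n → ℝ) → HMat n) (ξ : Heis n) (s : ℝ)
    (p : HIdx n → ℝ) : ℝ :=
  Real.sqrt (∑ i : HIdx n, ∑ j : HIdx n, ‖fderiv ℝ (fun η => L η s p i j) ξ‖ ^ 2)

/-- The matrix `p · ∇_p L(ξ,s,p)`. -/
def pDotGradL (L : Heis n → ℝ → (HIdx n → ℝ) → HMat n) (ξ : Heis n) (s : ℝ)
    (p : HIdx n → ℝ) : HMat n :=
  Matrix.of fun i j => fderiv ℝ (fun q => L ξ s q i j) p p

/-- Structural condition (3.3): `|∇_ξ L(ξ,s,p)| ≤ C|p|^m` and `|∇_p L(ξ,s,p)| ≤ C|p|`. -/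
def Cond33 (Ω : Set (Heis n)) (L : Heis n → ℝ → (HIdx n → ℝ) → HMat n) (m : ℝ) : Prop :=
  ∀ R : ℝ, 0 < R → ∃ C : ℝ, 0 < C ∧ ∀ ξ ∈ Ω, ∀ s : ℝ, |s| ≤ R → ∀ p : HIdx n → ℝ,
    (DiffInXi L ξ s p → xiGradNorm L ξ s p ≤ C * pnorm p ^ m) ∧
    (DiffInP L ξ s p → pGradNorm L ξ s p ≤ C * pnorm p)

/-- Structural condition (3.4): `0 ≤ L(ξ,s',p) - L(ξ,s,p) ≤ C(s'-s)|p|^m I₂ₙ`. -/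
def Cond34 (Ω : Set (Heis n)) (L : Heis n → ℝ → (HIdx n → ℝ) → HMat n) (m : ℝ) : Prop :=
  ∀ R : ℝ, 0 < R → ∃ C : ℝ, 0 < C ∧ ∀ ξ ∈ Ω, ∀ s s' : ℝ, -R ≤ s → s ≤ s' → s' ≤ R →
    ∀ p : HIdx n → ℝ,
      matLE 0 (L ξ s' p - L ξ s p) ∧
      matLE (L ξ s' p - L ξ s p) ((C * (s' - s) * pnorm p ^ m) • (1 : HMat n))

/-- The second inequality of condition (3.4): `L(ξ,s',p) - L(ξ,s,p) ≤ C(s'-s)|p|^m I₂ₙ`. -/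
def Cond34Upper (Ω : Set (Heis n)) (L : Heis n → ℝ → (HIdx n → ℝ) → HMat n) (m : ℝ) : Prop :=
  ∀ R : ℝ, 0 < R → ∃ C : ℝ, 0 < C ∧ ∀ ξ ∈ Ω, ∀ s s' : ℝ, -R ≤ s → s ≤ s' → s' ≤ R →
    ∀ p : HIdx n → ℝ,
      matLE (L ξ s' p - L ξ s p) ((C * (s' - s) * pnorm p ^ m) • (1 : HMat n))

/-- Structural condition (3.5). -/
def Cond35 (Ω : Set (Heis n)) (L : Heis n → ℝ → (HIdx n → ℝ) → HMat n) (m : ℝ) : Prop :=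
  ∀ R : ℝ, 0 < R → ∀ Λ : ℝ, 0 < Λ → ∃ θb : ℝ, 0 < θb ∧ ∃ C : ℝ, 0 < C ∧
    ∀ θ : ℝ, 0 ≤ θ → θ ≤ θb → ∀ ξ ∈ Ω, ∀ s : ℝ, |s| ≤ R → ∀ p : HIdx n → ℝ,
      DiffInP L ξ s p →
      matLE (pDotGradL L ξ s p - L ξ s p + (θ * Λ * pGradNorm L ξ s p) • (1 : HMat n)
              - θ • (1 : HMat n))
            (C • vecMulVec p p - ((1 / C) * pnorm p ^ m) • (1 : HMat n))

/-- Structural condition (3.7). -/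
def Cond37 (Ω : Set (Heis n)) (L : Heis n → ℝ → (HIdx n → ℝ) → HMat n) (m : ℝ) : Prop :=
  ∀ R : ℝ, 0 < R → ∀ Λ : ℝ, 0 < Λ → ∃ θb : ℝ, 0 < θb ∧ ∃ C : ℝ, 0 < C ∧
    ∀ θ : ℝ, 0 < θ → θ ≤ θb → ∀ ξ ∈ Ω, ∀ s : ℝ, |s| ≤ R → ∀ p : HIdx n → ℝ,
      DiffInP L ξ s p →
      matLE ((-C) • vecMulVec p p + ((1 / C) * pnorm p ^ m) • (1 : HMat n))
            (pDotGradL L ξ s p - L ξ s p - (θ * Λ * pGradNorm L ξ s p) • (1 : HMat n)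
              + θ • (1 : HMat n))

/-- `P` is a second-order Taylor witness for `u` at `ξ`: `u` is punctually second order
differentiable at `ξ` with expansion given by the `C²` function `P`. -/
def PunctualWitness (u P : Heis n → ℝ) (ξ : Heis n) : Prop :=
  ContDiff ℝ 2 P ∧ P ξ = u ξ ∧
    (fun η => u η - P η) =o[nhds ξ] (fun η => ‖η - ξ‖ ^ 2)

/-- The `ε`-lower envelope `w_ε`. -/
def lowerEnv (Ω : Set (Heis n)) (w : Heis n → EReal) (ε : ℝ) (ξ : Heis n) : EReal :=
  ⨅ η ∈ closure Ω, (w η + (((1 / ε) * hnorm (hmul (hinv η) ξ) ^ 4 : ℝ) : EReal))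

/-- The `ε`-upper envelope `v^ε`. -/
def upperEnv (Ω : Set (Heis n)) (v : Heis n → EReal) (ε : ℝ) (ξ : Heis n) : EReal :=
  ⨆ η ∈ closure Ω, (v η - (((1 / ε) * hnorm (hmul (hinv η) ξ) ^ 4 : ℝ) : EReal))

/-- The `ε`-lower envelope, as a real valued function. -/
def lowerEnvR (Ω : Set (Heis n)) (w : Heis n → EReal) (ε : ℝ) (ξ : Heis n) : ℝ :=
  (lowerEnv Ω w ε ξ).toReal

/-- The `ε`-upper envelope, as a real valued function. -/
def upperEnvR (Ω : Set (Heis n)) (v : Heis n → EReal) (ε : ℝ) (ξ : Heis n) : ℝ :=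
  (upperEnv Ω v ε ξ).toReal

/-- The lower semicontinuous envelope `g_*` relative to `O`. -/
def lscEnv (O : Set (Heis n)) (g : Heis n → EReal) (ξ : Heis n) : EReal :=
  ⨆ (r : ℝ) (_ : 0 < r), ⨅ η ∈ O ∩ Metric.ball ξ r, g η

/-- The upper semicontinuous envelope `g^*` relative to `O`. -/
def uscEnv (O : Set (Heis n)) (g : Heis n → EReal) (ξ : Heis n) : EReal :=
  ⨅ (r : ℝ) (_ : 0 < r), ⨆ η ∈ O ∩ Metric.ball ξ r, g η

end Heis

open Heis

section Alexandrov

variable {E : Type*} [NormedAddCommGroup E] [InnerProductSpace ℝ E]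

/-- `s` is a subgradient of `c` at `x`. -/
def PtIsSub (c : E → ℝ) (x s : E) : Prop := ∀ y, c x + inner ℝ s (y - x) ≤ c y

theorem PtIsSub.convexOn {c : E → ℝ} (h : ∀ x, ∃ s, PtIsSub c x s) : ConvexOn ℝ Set.univ c := by
  refine ⟨convex_univ, ?_⟩
  intro x _ y _ a b ha hb hab
  obtain ⟨s, hs⟩ := h (a • x + b • y)
  have h1 := hs x
  have h2 := hs y
  have h3 : a * inner ℝ s (x - (a • x + b • y)) + b * inner ℝ s (y - (a • x + b • y)) = 0 := by
    rw [← real_inner_smul_right, ← real_inner_smul_right, ← inner_add_right]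
    have : a • (x - (a • x + b • y)) + b • (y - (a • x + b • y)) = 0 := by
      have hb' : b = 1 - a := by linarith
      subst hb'
      module
    rw [this, inner_zero_right]
  have h4 := mul_le_mul_of_nonneg_left h1 ha
  have h5 := mul_le_mul_of_nonneg_left h2 hb
  simp only [smul_eq_mul]
  have h6 : c (a • x + b • y) = a * c (a • x + b • y) + b * c (a • x + b • y) := by
    rw [← add_mul, hab, one_mul]
  linarith

theorem PtIsSub.continuous [FiniteDimensional ℝ E] {c : E → ℝ} (h : ∀ x, ∃ s, PtIsSub c x s) :
    Continuous c :=
  (ConvexOn.locallyLipschitz (PtIsSub.convexOn h)).continuous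

theorem PtIsSub.prox {c : E → ℝ} {x₁ x₂ y₁ y₂ : E} (h1 : PtIsSub c x₁ (y₁ - x₁))
    (h2 : PtIsSub c x₂ (y₂ - x₂)) : ‖x₁ - x₂‖ ≤ ‖y₁ - y₂‖ := by
  have a1 := h1 x₂
  have a2 := h2 x₁
  have key : ‖x₁ - x₂‖ ^ 2 ≤ inner ℝ (y₁ - y₂) (x₁ - x₂) := by
    rw [← real_inner_self_eq_norm_sq]
    have e1 : inner ℝ (y₁ - x₁) (x₂ - x₁) = - inner ℝ (y₁ - x₁) (x₁ - x₂) := by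
      rw [← inner_neg_right, neg_sub]
    have e2 : inner ℝ (y₁ - y₂) (x₁ - x₂) =
      inner ℝ (y₁ - x₁) (x₁ - x₂) - inner ℝ (y₂ - x₂) (x₁ - x₂) + inner ℝ (x₁ - x₂) (x₁ - x₂) := by
      rw [← inner_sub_left, ← inner_add_left]; congr 1; abel
    rw [e1] at a1
    rw [e2]; linarith
  have h3 := real_inner_le_norm (y₁ - y₂) (x₁ - x₂)
  by_contra hc
  push Not at hc
  have : 0 < ‖x₁ - x₂‖ := lt_of_le_of_lt (norm_nonneg _) hc
  nlinarith

theorem ptTelescope {ψ : ℝ → ℝ} {ε C : ℝ}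
    (h : ∀ t t', 0 ≤ t → t ≤ t' → t' ≤ 1 → |ψ t' - ψ t| ≤ (t' - t) * (ε + C * (t' - t))) :
    |ψ 1 - ψ 0| ≤ ε := by
  have hm : ∀ m : ℕ, |ψ 1 - ψ 0| ≤ ε + C * (1 / ((m : ℝ) + 1)) := by
    intro m
    have hpos : (0 : ℝ) < (m : ℝ) + 1 := by positivity
    have h1 : ψ 1 - ψ 0 = ∑ i ∈ Finset.range (m + 1),
        (ψ (((i + 1 : ℕ) : ℝ) / ((m : ℝ) + 1)) - ψ ((i : ℝ) / ((m : ℝ) + 1))) := by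
      rw [Finset.sum_range_sub (fun i : ℕ => ψ ((i : ℝ) / ((m : ℝ) + 1)))]
      have : ((m + 1 : ℕ) : ℝ) / ((m : ℝ) + 1) = 1 := by
        push_cast; field_simp
      rw [this]; simp
    rw [h1]
    refine (Finset.abs_sum_le_sum_abs _ _).trans ?_
    have h2 : ∀ i ∈ Finset.range (m + 1),
        |ψ (((i + 1 : ℕ) : ℝ) / ((m : ℝ) + 1)) - ψ ((i : ℝ) / ((m : ℝ) + 1))| ≤
          (1 / ((m : ℝ) + 1)) * (ε + C * (1 / ((m : ℝ) + 1))) := by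
      intro i hi
      have hi' : ((i : ℝ) + 1) ≤ (m : ℝ) + 1 := by
        have := Finset.mem_range.1 hi
        exact_mod_cast this
      have h3 := h ((i : ℝ) / ((m : ℝ) + 1)) (((i + 1 : ℕ) : ℝ) / ((m : ℝ) + 1)) (by positivity)
        (by push_cast; gcongr; linarith)
        (by push_cast; rw [div_le_one hpos]; exact hi')
      have h4 : ((i + 1 : ℕ) : ℝ) / ((m : ℝ) + 1) - (i : ℝ) / ((m : ℝ) + 1) = 1 / ((m : ℝ) + 1) := by
        push_cast; field_simp; ring
      rw [h4] at h3
      exact h3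
    refine (Finset.sum_le_sum h2).trans ?_
    rw [Finset.sum_const, Finset.card_range, nsmul_eq_mul]
    push_cast
    apply le_of_eq
    field_simp
  have hlim : Tendsto (fun m : ℕ => ε + C * (1 / ((m : ℝ) + 1))) atTop (𝓝 (ε + C * 0)) :=
    (tendsto_one_div_add_atTop_nhds_zero_nat.const_mul C).const_add ε
  have := ge_of_tendsto' hlim hm
  simpa using this

/-- If a selection of subgradients is differentiable at `x`, `c` has a second order expansion. -/
theorem ptExpansion {c : E → ℝ} {sel : E → E} (hsel : ∀ x, PtIsSub c x (sel x)) (x : E)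
    (B : E →L[ℝ] E)
    (hB : (fun h => sel (x + h) - sel x - B h) =o[𝓝 0] (fun h : E => h)) :
    (fun h => c (x + h) - c x - inner ℝ (sel x) h - (1 / 2) * inner ℝ (B h) h)
      =o[𝓝 0] (fun h : E => ‖h‖ ^ 2) := by
  rw [Asymptotics.isLittleO_iff]
  intro ε hε
  rw [Asymptotics.isLittleO_iff] at hB
  obtain ⟨r, hr, hr'⟩ := Metric.eventually_nhds_iff_ball.1 (hB hε)
  refine Metric.eventually_nhds_iff_ball.2 ⟨r, hr, ?_⟩
  intro h hh
  have hR : ∀ t : ℝ, 0 ≤ t → t ≤ 1 →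
      |inner ℝ (sel (x + t • h) - sel x - B (t • h)) h| ≤ ε * ‖h‖ ^ 2 := by
    intro t ht0 ht1
    have hn : ‖t • h‖ ≤ ‖h‖ := by
      rw [norm_smul, Real.norm_of_nonneg ht0]
      exact mul_le_of_le_one_left (norm_nonneg _) ht1
    have h1 := hr' (t • h) (by
      rw [mem_ball_zero_iff] at hh ⊢
      exact lt_of_le_of_lt hn hh)
    refine (abs_real_inner_le_norm _ _).trans ?_
    calc _ ≤ (ε * ‖t • h‖) * ‖h‖ := by gcongr
      _ ≤ (ε * ‖h‖) * ‖h‖ := by gcongr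
      _ = ε * ‖h‖ ^ 2 := by ring
  have key := ptTelescope (ψ := fun t => c (x + t • h) - t * inner ℝ (sel x) h
      - t ^ 2 / 2 * inner ℝ (B h) h) (ε := ε * ‖h‖ ^ 2) (C := |inner ℝ (B h) h|) (by
    intro t t' h0 htt h1
    have hs1 := hsel (x + t • h) (x + t' • h)
    have hs2 := hsel (x + t' • h) (x + t • h)
    have e1 : x + t' • h - (x + t • h) = (t' - t) • h := by module
    have e2 : x + t • h - (x + t' • h) = (-(t' - t)) • h := by module
    rw [e1, inner_smul_right] at hs1
    rw [e2, inner_smul_right] at hs2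
    have r1 := abs_le.1 (hR t h0 (htt.trans h1))
    have r2 := abs_le.1 (hR t' (h0.trans htt) h1)
    simp only [inner_sub_left, map_smul, inner_smul_left, conj_trivial] at r1 r2
    have hd : 0 ≤ t' - t := by linarith
    have b1 := le_abs_self (inner ℝ (B h) h)
    have b2 := neg_abs_le (inner ℝ (B h) h)
    set b := inner ℝ (B h) h
    set S1 := inner ℝ (sel (x + t • h)) h
    set S2 := inner ℝ (sel (x + t' • h)) h
    set S0 := inner ℝ (sel x) h
    have q1 := mul_le_mul_of_nonneg_left r1.1 hd
    have q2 := mul_le_mul_of_nonneg_left r2.2 hd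
    have q3 := mul_le_mul_of_nonneg_left b1 (mul_nonneg hd hd)
    have q4 := mul_le_mul_of_nonneg_left b2 (mul_nonneg hd hd)
    have q5 : 0 ≤ (t' - t) * (t' - t) * |b| := by positivity
    rw [abs_le]
    constructor
    · nlinarith
    · nlinarith)
  simp only [one_smul, zero_smul, add_zero, one_mul, zero_mul] at key
  rw [Real.norm_eq_abs, Real.norm_of_nonneg (by positivity)]
  refine le_trans (le_of_eq ?_) key
  congr 1
  ring

variable [FiniteDimensional ℝ E]

theorem ptSelBounded {c : E → ℝ} {sel : E → E} (hsel : ∀ x, PtIsSub c x (sel x)) (x : E) :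
    ∃ M, ∀ h : E, ‖h‖ ≤ 1 → ‖sel (x + h)‖ ≤ M := by
  have hc : Continuous c := PtIsSub.continuous (fun x => ⟨sel x, hsel x⟩)
  obtain ⟨M, hM⟩ := (isCompact_closedBall x 2).exists_bound_of_continuousOn hc.continuousOn
  refine ⟨2 * M, fun h hh => ?_⟩
  by_cases h0 : sel (x + h) = 0
  · rw [h0, norm_zero]
    have := (norm_nonneg _).trans (hM x (by simp))
    linarith
  have hp : 0 < ‖sel (x + h)‖ := norm_pos_iff.2 h0
  have h1 := hsel (x + h) (x + h + (‖sel (x + h)‖)⁻¹ • sel (x + h))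
  rw [add_sub_cancel_left, inner_smul_right, real_inner_self_eq_norm_sq] at h1
  have h2 : ‖sel (x + h)‖⁻¹ * ‖sel (x + h)‖ ^ 2 = ‖sel (x + h)‖ := by field_simp
  rw [h2] at h1
  have h3 := hM (x + h) (by rw [mem_closedBall_iff_norm]; simp; linarith)
  have h4 := hM (x + h + (‖sel (x + h)‖)⁻¹ • sel (x + h)) (by
    rw [mem_closedBall_iff_norm]
    have : x + h + (‖sel (x + h)‖)⁻¹ • sel (x + h) - x = h + (‖sel (x + h)‖)⁻¹ • sel (x + h) := by
      abel
    rw [this]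
    refine (norm_add_le _ _).trans ?_
    rw [norm_smul, norm_inv, norm_norm, inv_mul_cancel₀ hp.ne']
    linarith)
  rw [Real.norm_eq_abs, abs_le] at h3 h4
  linarith [h3.1, h4.2]

variable [MeasurableSpace E] [BorelSpace E]

open MeasureTheory in
/-- Alexandrov's theorem. -/
theorem ptAlexandrov {c : E → ℝ} (h : ∀ x, ∃ s, PtIsSub c x s) :
    ∃ Z : Set E, (Measure.hausdorffMeasure (Module.finrank ℝ E : ℝ) : Measure E) Z = 0 ∧
      ∀ x ∉ Z, ∃ s : E, ∃ B : E →L[ℝ] E,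
        (fun h => c (x + h) - c x - inner ℝ s h - (1 / 2) * inner ℝ (B h) h)
          =o[𝓝 0] (fun h : E => ‖h‖ ^ 2) := by
  have hc : Continuous c := PtIsSub.continuous h
  choose sel hsel using h
  set R : Set E := {y | ∃ x, PtIsSub c x (y - x)} with hR
  have hR' : ∀ y, ∃ x, y ∈ R → PtIsSub c x (y - x) := by
    intro y
    by_cases hy : y ∈ R
    · obtain ⟨x, hx⟩ := hy
      exact ⟨x, fun _ => hx⟩
    · exact ⟨0, fun h => absurd h hy⟩
  choose P hP using hR'
  have hPlip : LipschitzOnWith 1 P R := by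
    refine LipschitzOnWith.of_dist_le_mul ?_
    intro y hy y' hy'
    rw [dist_eq_norm, dist_eq_norm, NNReal.coe_one, one_mul]
    exact PtIsSub.prox (hP y hy) (hP y' hy')
  obtain ⟨Q, hQlip, hQ⟩ := hPlip.extend_finite_dimension
  have hQP : ∀ x s, PtIsSub c x s → Q (x + s) = x := by
    intro x s hs
    have hm : x + s ∈ R := ⟨x, by simpa using hs⟩
    rw [← hQ hm]
    have h1 := PtIsSub.prox (y₁ := x + s) (y₂ := x + s) (x₁ := P (x + s)) (x₂ := x)
      (hP _ hm) (by simpa using hs)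
    rw [sub_self, norm_zero] at h1
    exact sub_eq_zero.1 (norm_le_zero_iff.1 h1)
  set N1 : Set E := {y | ¬ DifferentiableAt ℝ Q y}
  set N2 : Set E := {y | DifferentiableAt ℝ Q y ∧ (fderiv ℝ Q y).det = 0}
  refine ⟨Q '' N1 ∪ Q '' N2, ?_, ?_⟩
  · rw [measure_union_null_iff]
    constructor
    · have h1 : (Measure.hausdorffMeasure (Module.finrank ℝ E : ℝ) : Measure E) N1 = 0 :=
        hQlip.ae_differentiableAt
      have h2 := hQlip.hausdorffMeasure_image_le (d := (Module.finrank ℝ E : ℝ)) (by positivity) N1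
      rw [h1, mul_zero] at h2
      exact le_antisymm h2 (zero_le)
    · exact addHaar_image_eq_zero_of_det_fderivWithin_eq_zero _ (f' := fun y => fderiv ℝ Q y)
        (fun y hy => hy.1.hasFDerivAt.hasFDerivWithinAt) (fun y hy => hy.2)
  · intro x hx
    have hxy := hQP x (sel x) (hsel x)
    set y := x + sel x with hy
    have hd : DifferentiableAt ℝ Q y := by
      by_contra hcon
      exact hx (Or.inl ⟨y, hcon, hxy⟩)
    have hdet : (fderiv ℝ Q y).det ≠ 0 := by
      intro hcon
      exact hx (Or.inr ⟨y, ⟨hd, hcon⟩, hxy⟩)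
    set D := (fderiv ℝ Q y).toContinuousLinearEquivOfDetNeZero hdet with hD
    have hDd : HasFDerivAt Q (D : E →L[ℝ] E) y := by
      have := hd.hasFDerivAt
      simpa [hD] using this
    -- uniqueness of the subgradient
    have huniq : ∀ s, PtIsSub c x s → s = sel x := by
      intro s hs
      have hconst : ∀ t ∈ Set.Icc (0 : ℝ) 1, Q (y + t • (s - sel x)) = x := by
        intro t ht
        have e : y + t • (s - sel x) = x + ((1 - t) • sel x + t • s) := by
          rw [hy]; module
        rw [e]
        apply hQP
        intro z
        rw [inner_add_left, inner_smul_left, inner_smul_left]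
        simp only [conj_trivial]
        have i1 := mul_le_mul_of_nonneg_left (hsel x z) (sub_nonneg.2 ht.2)
        have i2 := mul_le_mul_of_nonneg_left (hs z) ht.1
        linarith
      have hl : HasDerivWithinAt (fun t : ℝ => Q (y + t • (s - sel x)))
          (D (s - sel x)) (Set.Icc 0 1) 0 := by
        have h1 : HasDerivAt (fun t : ℝ => y + t • (s - sel x)) (s - sel x) 0 := by
          simpa using ((hasDerivAt_id (0 : ℝ)).smul_const (s - sel x)).const_add y
        have h2 : HasFDerivAt Q (D : E →L[ℝ] E) (y + (0 : ℝ) • (s - sel x)) := by simpa using hDd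
        exact (h2.comp_hasDerivAt (0 : ℝ) h1).hasDerivWithinAt
      have hl2 : HasDerivWithinAt (fun t : ℝ => Q (y + t • (s - sel x)))
          0 (Set.Icc 0 1) 0 := by
        refine (hasDerivWithinAt_const (0 : ℝ) (Set.Icc (0 : ℝ) 1) x).congr hconst ?_
        exact hconst 0 (by simp)
      have hu : UniqueDiffWithinAt ℝ (Set.Icc (0 : ℝ) 1) 0 :=
        uniqueDiffOn_Icc zero_lt_one 0 (by simp)
      have h0 : D (s - sel x) = 0 := hu.eq_deriv _ hl hl2
      have := (map_eq_zero_iff D D.injective).1 h0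
      exact sub_eq_zero.1 this
    -- continuity of the selection
    obtain ⟨M, hM⟩ := ptSelBounded hsel x
    have hcont : Tendsto (fun h => sel (x + h)) (𝓝 0) (𝓝 (sel x)) := by
      refine (isCompact_closedBall (0 : E) M).tendsto_nhds_of_unique_mapClusterPt ?_ ?_
      · filter_upwards [Metric.closedBall_mem_nhds (0 : E) zero_lt_one] with h hh
        rw [mem_closedBall_zero_iff] at hh ⊢
        exact hM h hh
      · intro s _ hs
        apply huniq
        obtain ⟨U, hU, hUs⟩ := mapClusterPt_iff_ultrafilter.1 hs
        intro z
        have hxh : Tendsto (fun h : E => x + h) U (𝓝 x) := by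
          have : Tendsto (fun h : E => x + h) (𝓝 0) (𝓝 (x + 0)) := tendsto_id.const_add x
          rw [add_zero] at this
          exact this.mono_left hU
        have hlim : Tendsto (fun h => c (x + h) + inner ℝ (sel (x + h)) (z - (x + h))) U
            (𝓝 (c x + inner ℝ s (z - x))) :=
          ((hc.tendsto x).comp hxh).add (hUs.inner (tendsto_const_nhds.sub hxh))
        exact le_of_tendsto' hlim (fun h => hsel (x + h) z)
    refine ⟨sel x, (D.symm : E →L[ℝ] E) - ContinuousLinearMap.id ℝ E, ptExpansion hsel x _ ?_⟩
    set k : E → E := fun h => h + sel (x + h) - sel x with hk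
    have hk0 : Tendsto (fun h => y + k h) (𝓝 0) (𝓝 y) := by
      have h1 : Tendsto k (𝓝 0) (𝓝 (0 + sel x - sel x)) :=
        (tendsto_id.add hcont).sub tendsto_const_nhds
      have h2 := h1.const_add y
      simpa using h2
    have h1 : (fun h => Q (y + k h) - Q y - D (y + k h - y)) =o[𝓝 0] (fun h => y + k h - y) :=
      hDd.isLittleO.comp_tendsto hk0
    have h2 : (fun h => h - D (k h)) =o[𝓝 0] k := by
      have e1 : ∀ h, Q (y + k h) = x + h := by
        intro h
        have : y + k h = (x + h) + sel (x + h) := by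
          rw [hy, hk]; simp only; abel
        rw [this]
        exact hQP _ _ (hsel _)
      refine (h1.congr (fun h => ?_) (fun h => ?_))
      · rw [e1, hxy]; simp
      · simp
    have h3 : (fun h => k h - D.symm h) =o[𝓝 0] k := by
      have := ((D.symm : E →L[ℝ] E).isBigO_comp (fun h => h - D (k h)) (𝓝 0)).trans_isLittleO h2
      refine this.neg_left.congr_left ?_
      intro h
      simp
    have h4 : k =O[𝓝 0] (fun h : E => h) := by
      have h5 := h3.right_isBigO_sub
      refine h5.trans ?_
      refine (Asymptotics.IsBigO.congr_left
        ((D.symm : E →L[ℝ] E).isBigO_id (𝓝 0)) ?_)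
      intro h; simp
    refine (h3.trans_isBigO h4).congr_left ?_
    intro h
    simp [hk]
    abel

end Alexandrov

section Jensen

variable {E : Type*} [NormedAddCommGroup E] [InnerProductSpace ℝ E]

/-- subgradients of semiconvex functions -/
theorem ptSemiconvexSub {a : E → ℝ} {Λ : ℝ} {x s : E}
    (h : ∀ y, a x + inner ℝ s (y - x) - Λ * ‖y - x‖ ^ 2 ≤ a y) :
    PtIsSub (fun z => a z + Λ * ‖z‖ ^ 2) x (s + (2 * Λ) • x) := by
  intro y
  have h1 := h y
  have e : ‖y - x‖ ^ 2 = ‖y‖ ^ 2 - 2 * inner ℝ x y + ‖x‖ ^ 2 := by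
    rw [norm_sub_sq_real, real_inner_comm]
  rw [e] at h1
  simp only
  rw [inner_add_left, real_inner_smul_left, inner_sub_right x, real_inner_self_eq_norm_sq]
  linarith

variable [FiniteDimensional ℝ E] [MeasurableSpace E] [BorelSpace E]

theorem ptSemiconvexCont {a : E → ℝ} {Λ : ℝ}
    (h : ∀ x, ∃ s, ∀ y, a x + inner ℝ s (y - x) - Λ * ‖y - x‖ ^ 2 ≤ a y) : Continuous a := by
  have h1 : Continuous (fun z => a z + Λ * ‖z‖ ^ 2) := by
    apply PtIsSub.continuous
    intro x
    obtain ⟨s, hs⟩ := h x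
    exact ⟨_, ptSemiconvexSub hs⟩
  have h2 : Continuous (fun z : E => Λ * ‖z‖ ^ 2) := by fun_prop
  have h3 := h1.sub h2
  have h4 : ((fun z => a z + Λ * ‖z‖ ^ 2) - fun z => Λ * ‖z‖ ^ 2) = a := by
    funext z; simp
  rwa [h4] at h3

theorem ptAlexandrovSemi {a : E → ℝ} {Λ : ℝ}
    (h : ∀ x, ∃ s, ∀ y, a x + inner ℝ s (y - x) - Λ * ‖y - x‖ ^ 2 ≤ a y) :
    ∃ Z : Set E, (MeasureTheory.Measure.hausdorffMeasure (Module.finrank ℝ E : ℝ) :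
        MeasureTheory.Measure E) Z = 0 ∧
      ∀ x ∉ Z, ∃ s : E, ∃ B : E →L[ℝ] E,
        (fun h => a (x + h) - a x - inner ℝ s h - (1 / 2) * inner ℝ (B h) h)
          =o[𝓝 0] (fun h : E => ‖h‖ ^ 2) := by
  obtain ⟨Z, hZ, hZ'⟩ := ptAlexandrov (c := fun z => a z + Λ * ‖z‖ ^ 2) (by
    intro x
    obtain ⟨s, hs⟩ := h x
    exact ⟨_, ptSemiconvexSub hs⟩)
  refine ⟨Z, hZ, fun x hx => ?_⟩
  obtain ⟨s, B, hB⟩ := hZ' x hx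
  refine ⟨s - (2 * Λ) • x, B - (2 * Λ) • ContinuousLinearMap.id ℝ E, hB.congr_left ?_⟩
  intro h
  simp only [inner_sub_left, real_inner_smul_left, _root_.sub_apply,
    _root_.smul_apply, ContinuousLinearMap.id_apply, real_inner_self_eq_norm_sq,
    norm_add_sq_real]
  ring

open MeasureTheory in
theorem ptJensen {f : E → ℝ} {Λ μ : ℝ} (hΛ : 0 < Λ) (hμ : 0 < μ)
    (h : ∀ x, ∃ s, ∀ y, f x + inner ℝ s (y - x) - Λ * ‖y - x‖ ^ 2 ≤ f y)
    (x₀ : E) (hmax : ∀ y, f y ≤ f x₀ - μ * ‖y - x₀‖ ^ 2)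
    (Z : Set E) (hZ : (Measure.hausdorffMeasure (Module.finrank ℝ E : ℝ) : Measure E) Z = 0)
    (δ : ℝ) (hδ : 0 < δ) :
    ∃ x ∉ Z, ‖x - x₀‖ < δ ∧ ∃ p : E, ‖p‖ < δ ∧ ∀ y, f y ≤ f x + inner ℝ p (y - x) := by
  have hf := ptSemiconvexCont h
  set r := δ / 2 with hr
  have hrpos : 0 < r := by positivity
  set δ' := min δ (μ * r) with hδ'
  have hδ'pos : 0 < δ' := lt_min hδ (by positivity)
  have hex : ∀ p : E, ∃ x, ‖p‖ < δ' → ‖x - x₀‖ ≤ r ∧ ∀ y, f y ≤ f x + inner ℝ p (y - x) := by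
    intro p
    by_cases hp : ‖p‖ < δ'
    swap
    · exact ⟨0, fun h => absurd h hp⟩
    have hpr : ‖p‖ ≤ μ * r := hp.le.trans (min_le_right _ _)
    have hcont : Continuous (fun y => f y - inner ℝ p y) := by fun_prop
    obtain ⟨x, hx, hxm⟩ := (isCompact_closedBall x₀ r).exists_isMaxOn
      ⟨x₀, by simp [hrpos.le]⟩ hcont.continuousOn
    refine ⟨x, fun _ => ⟨mem_closedBall_iff_norm.1 hx, fun y => ?_⟩⟩
    rw [inner_sub_right]
    by_cases hy : ‖y - x₀‖ ≤ r
    · have := hxm (mem_closedBall_iff_norm.2 hy)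
      simp only [Set.mem_ofPred_eq] at this
      linarith
    · push Not at hy
      have h1 := hmax y
      have h2 := hxm (show x₀ ∈ Metric.closedBall x₀ r by simp [hrpos.le])
      simp only [Set.mem_ofPred_eq] at h2
      have h3 := (abs_le.1 (abs_real_inner_le_norm p (y - x₀))).1
      rw [inner_sub_right] at h3
      have h4 : ‖p‖ * ‖y - x₀‖ ≤ μ * ‖y - x₀‖ ^ 2 := by
        calc _ ≤ (μ * r) * ‖y - x₀‖ := by gcongr
          _ ≤ (μ * ‖y - x₀‖) * ‖y - x₀‖ := by gcongr
          _ = _ := by ring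
      linarith
  choose X hX using hex
  by_contra hcon
  have hall : ∀ p : E, ‖p‖ < δ' → X p ∈ Z := by
    intro p hp
    by_contra hz
    obtain ⟨h1, h2⟩ := hX p hp
    exact hcon ⟨X p, hz, by linarith, p, lt_of_lt_of_le hp (min_le_left _ _), h2⟩
  -- lower bound
  have hlow : ∀ p : E, ‖p‖ < δ' → ∀ y, f (X p) + inner ℝ p (y - X p) - Λ * ‖y - X p‖ ^ 2 ≤ f y := by
    intro p hp
    obtain ⟨s, hs⟩ := h (X p)
    have hsp : s = p := by
      have h1 := hs (X p + (1 / (2 * Λ)) • (s - p))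
      have h2 := (hX p hp).2 (X p + (1 / (2 * Λ)) • (s - p))
      rw [add_sub_cancel_left] at h1 h2
      rw [norm_smul, Real.norm_of_nonneg (by positivity)] at h1
      rw [real_inner_smul_right] at h1 h2
      have h3 : inner ℝ s (s - p) - inner ℝ p (s - p) = ‖s - p‖ ^ 2 := by
        rw [← inner_sub_left, real_inner_self_eq_norm_sq]
      have h4 : 1 / (2 * Λ) * ‖s - p‖ ^ 2 ≤ Λ * (1 / (2 * Λ) * ‖s - p‖) ^ 2 := by
        rw [← h3, mul_sub]; linarith
      have h5 : Λ * (1 / (2 * Λ) * ‖s - p‖) ^ 2 = 1 / 2 * (1 / (2 * Λ) * ‖s - p‖ ^ 2) := by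
        field_simp
      have h6 : 1 / (2 * Λ) * ‖s - p‖ ^ 2 ≤ 0 := by linarith
      have h7 : ‖s - p‖ ^ 2 ≤ 0 := by
        by_contra hc
        push Not at hc
        have : 0 < 1 / (2 * Λ) * ‖s - p‖ ^ 2 := by positivity
        linarith
      have h8 : ‖s - p‖ = 0 := by
        have := norm_nonneg (s - p)
        nlinarith
      exact sub_eq_zero.1 (norm_eq_zero.1 h8)
    rw [← hsp]
    rw [hsp] at hs ⊢
    exact hs
  have hlip : ∀ p q : E, ‖p‖ < δ' → ‖q‖ < δ' → ‖p - q‖ ≤ 2 * Λ * ‖X p - X q‖ := by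
    intro p q hp hq
    by_cases hpq : p = q
    · subst hpq; simp
    have hn : 0 < ‖p - q‖ := norm_pos_iff.2 (sub_ne_zero.2 hpq)
    set τ := ‖X p - X q‖ with hτ
    -- test at y = X q - t (p-q)
    have gen : ∀ t : ℝ, t * ‖p - q‖ ^ 2 ≤ Λ * τ ^ 2 + Λ * (t * ‖p - q‖) ^ 2 := by
      intro t
      have h1 := (hX p hp).2 (X q - t • (p - q))
      have h2 := hlow q hq (X q - t • (p - q))
      have h3 := hlow p hp (X q)
      have e1 : X q - t • (p - q) - X q = - (t • (p - q)) := by abel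
      have e2 : X q - t • (p - q) - X p = (X q - X p) - t • (p - q) := by abel
      rw [e1, norm_neg, inner_neg_right, real_inner_smul_right, norm_smul, mul_pow,
        Real.norm_eq_abs, sq_abs] at h2
      rw [e2, inner_sub_right, real_inner_smul_right] at h1
      rw [norm_sub_rev (X q) (X p), ← hτ] at h3
      have e3 : inner ℝ p (p - q) - inner ℝ q (p - q) = ‖p - q‖ ^ 2 := by
        rw [← inner_sub_left, real_inner_self_eq_norm_sq]
      rw [← e3, mul_sub, mul_pow, ← e3]
      rw [← e3] at h2
      linarith
    have hτ0 : 0 ≤ τ := norm_nonneg _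
    have h1 := gen (τ / ‖p - q‖)
    have e1 : τ / ‖p - q‖ * ‖p - q‖ ^ 2 = τ * ‖p - q‖ := by field_simp
    have e2 : τ / ‖p - q‖ * ‖p - q‖ = τ := by field_simp
    rw [e1, e2] at h1
    rcases hτ0.eq_or_lt with h0 | h0
    · rw [← h0]
      have h2 := gen (1 / (2 * Λ))
      rw [← h0] at h2
      have h5 : Λ * (1 / (2 * Λ) * ‖p - q‖) ^ 2 = 1 / 2 * (1 / (2 * Λ) * ‖p - q‖ ^ 2) := by
        field_simp
      have : 0 < 1 / (2 * Λ) * ‖p - q‖ ^ 2 := by positivity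
      nlinarith
    · have : τ * ‖p - q‖ ≤ τ * (2 * Λ * τ) := by nlinarith
      exact le_of_mul_le_mul_left this h0
  -- inverse map
  set G : Set E := X '' Metric.ball 0 δ' with hG
  set q : E → E := Function.invFunOn X (Metric.ball 0 δ') with hq
  have hqm : ∀ x ∈ G, q x ∈ Metric.ball (0 : E) δ' ∧ X (q x) = x := by
    intro x hx
    exact ⟨Function.invFunOn_mem hx, Function.invFunOn_eq hx⟩
  have hqlip : LipschitzOnWith (Real.toNNReal (2 * Λ)) q G := by
    refine LipschitzOnWith.of_dist_le_mul ?_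
    intro x hx y hy
    rw [dist_eq_norm, dist_eq_norm, Real.coe_toNNReal _ (by positivity)]
    obtain ⟨hx1, hx2⟩ := hqm x hx
    obtain ⟨hy1, hy2⟩ := hqm y hy
    have := hlip (q x) (q y) (mem_ball_zero_iff.1 hx1) (mem_ball_zero_iff.1 hy1)
    rwa [hx2, hy2] at this
  have hGZ : G ⊆ Z := by
    rintro _ ⟨p, hp, rfl⟩
    exact hall p (mem_ball_zero_iff.1 hp)
  have hG0 : (Measure.hausdorffMeasure (Module.finrank ℝ E : ℝ) : Measure E) G = 0 :=
    measure_mono_null hGZ hZ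
  have himg : Metric.ball (0 : E) δ' ⊆ q '' G := by
    intro p hp
    refine ⟨X p, ⟨p, hp, rfl⟩, ?_⟩
    obtain ⟨h1, h2⟩ := hqm (X p) ⟨p, hp, rfl⟩
    have h3 := hlip (q (X p)) p (mem_ball_zero_iff.1 h1) (mem_ball_zero_iff.1 hp)
    rw [h2, sub_self, norm_zero, mul_zero] at h3
    exact sub_eq_zero.1 (norm_le_zero_iff.1 h3)
  have h1 := hqlip.hausdorffMeasure_image_le (d := (Module.finrank ℝ E : ℝ)) (by positivity)
  rw [hG0, mul_zero] at h1
  have h2 : (Measure.hausdorffMeasure (Module.finrank ℝ E : ℝ) : Measure E)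
      (Metric.ball (0 : E) δ') = 0 :=
    le_antisymm ((measure_mono himg).trans h1) zero_le
  exact (Metric.measure_ball_pos _ _ hδ'pos).ne' h2

/-- Jensen's lemma and Alexandrov's theorem combined. -/
theorem ptJA {a b : E → ℝ} {Λ : ℝ}
    (ha : ∀ x, ∃ s, ∀ y, a x + inner ℝ s (y - x) - Λ * ‖y - x‖ ^ 2 ≤ a y)
    (hb : ∀ x, ∃ s, ∀ y, b x + inner ℝ s (y - x) - Λ * ‖y - x‖ ^ 2 ≤ b y)
    (hΛ : 0 < Λ)
    (x₀ : E) (hmax : ∀ y, a y + b y ≤ a x₀ + b x₀) (δ : ℝ) (hδ : 0 < δ) :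
    ∃ x, ‖x - x₀‖ < δ ∧ a x₀ + b x₀ - δ ≤ a x + b x ∧ ∃ p q : E, ∃ A B : E →L[ℝ] E,
      (fun h => a (x + h) - a x - inner ℝ p h - (1 / 2) * inner ℝ (A h) h)
          =o[𝓝 0] (fun h : E => ‖h‖ ^ 2) ∧
      (fun h => b (x + h) - b x - inner ℝ q h - (1 / 2) * inner ℝ (B h) h)
          =o[𝓝 0] (fun h : E => ‖h‖ ^ 2) ∧
      ‖p + q‖ ≤ δ ∧ ∀ h, inner ℝ (A h) h + inner ℝ (B h) h ≤ δ * ‖h‖ ^ 2 := by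
  obtain ⟨Za, hZa, hZa'⟩ := ptAlexandrovSemi ha
  obtain ⟨Zb, hZb, hZb'⟩ := ptAlexandrovSemi hb
  set μ := min (δ / 8) 1 with hμd
  have hμ : 0 < μ := lt_min (by positivity) one_pos
  have hμδ : μ ≤ δ / 8 := min_le_left _ _
  have hμ1 : μ ≤ 1 := min_le_right _ _
  set δ' := min (δ / 8) 1 with hδd
  set f : E → ℝ := fun y => a y + b y - μ * ‖y - x₀‖ ^ 2 with hf
  have hsemi : ∀ x, ∃ s, ∀ y, f x + inner ℝ s (y - x) - (2 * Λ + μ) * ‖y - x‖ ^ 2 ≤ f y := by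
    intro x
    obtain ⟨s, hs⟩ := ha x
    obtain ⟨s', hs'⟩ := hb x
    refine ⟨s + s' - (2 * μ) • (x - x₀), fun y => ?_⟩
    have h1 := hs y
    have h2 := hs' y
    have e : ‖y - x₀‖ ^ 2 = ‖y - x‖ ^ 2 + 2 * inner ℝ (x - x₀) (y - x) + ‖x - x₀‖ ^ 2 := by
      have : y - x₀ = (y - x) + (x - x₀) := by abel
      rw [this, norm_add_sq_real, real_inner_comm]
    simp only [hf]
    rw [e, inner_sub_left, inner_add_left, real_inner_smul_left]
    linarith
  obtain ⟨x, hxZ, hxx, p, hp, hpm⟩ := ptJensen (f := f) (Λ := 2 * Λ + μ) (μ := μ) (by positivity) hμ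
    hsemi x₀ (by
      intro y
      simp only [hf, sub_self, norm_zero]
      have := hmax y
      nlinarith) (Za ∪ Zb)
    (MeasureTheory.measure_union_null hZa hZb) μ hμ
  obtain ⟨p1, A, hA⟩ := hZa' x (fun h => hxZ (Or.inl h))
  obtain ⟨p2, B, hB⟩ := hZb' x (fun h => hxZ (Or.inr h))
  have hsum := hA.add hB
  -- upper bound of f at x
  have hup : ∀ h, a (x + h) + b (x + h) ≤ a x + b x + inner ℝ (p + (2 * μ) • (x - x₀)) h
      + μ * ‖h‖ ^ 2 := by
    intro h
    have h1 := hpm (x + h)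
    simp only [hf, add_sub_cancel_left] at h1
    have e : ‖x + h - x₀‖ ^ 2 = ‖x - x₀‖ ^ 2 + 2 * inner ℝ (x - x₀) h + ‖h‖ ^ 2 := by
      have : x + h - x₀ = (x - x₀) + h := by abel
      rw [this, norm_add_sq_real]
    rw [e] at h1
    rw [inner_add_left, real_inner_smul_left]
    linarith
  set P := p + (2 * μ) • (x - x₀) with hPdef
  set k : E → ℝ := fun h => inner ℝ (p1 + p2 - P) h + 1 / 2 * (inner ℝ (A h) h + inner ℝ (B h) h)
    with hk
  -- k h ≤ μ‖h‖² + ε ‖h‖²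
  have hkev : ∀ ε > 0, ∀ᶠ h in 𝓝 (0 : E), k h ≤ μ * ‖h‖ ^ 2 + ε * ‖h‖ ^ 2 := by
    intro ε hε
    filter_upwards [Asymptotics.isLittleO_iff.1 hsum hε] with h hh
    rw [Real.norm_eq_abs, Real.norm_of_nonneg (by positivity), abs_le] at hh
    have := hup h
    have h2 := hh.1
    simp only [hk, inner_sub_left, inner_add_left]
    linarith
  have hline : ∀ h : E, ∀ ε > 0, ∀ᶠ t in 𝓝[>] (0 : ℝ),
      t * inner ℝ (p1 + p2 - P) h + t ^ 2 / 2 * (inner ℝ (A h) h + inner ℝ (B h) h)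
        ≤ (μ + ε) * t ^ 2 * ‖h‖ ^ 2 := by
    intro h ε hε
    have ht : Tendsto (fun t : ℝ => t • h) (𝓝[>] 0) (𝓝 0) := by
      have : Tendsto (fun t : ℝ => t • h) (𝓝 0) (𝓝 ((0 : ℝ) • h)) :=
        (continuous_id.smul continuous_const).tendsto 0
      rw [zero_smul] at this
      exact this.mono_left nhdsWithin_le_nhds
    filter_upwards [ht.eventually (hkev ε hε)] with t h1
    simp only [hk, map_smul, real_inner_smul_left, real_inner_smul_right, norm_smul, mul_pow,
      Real.norm_eq_abs, sq_abs] at h1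
    linarith
  have hgrad : p1 + p2 - P = 0 := by
    by_contra hne
    set g := p1 + p2 - P
    have hg : 0 < ‖g‖ ^ 2 := by
      have := norm_pos_iff.2 hne
      positivity
    have h1 := hline g 1 one_pos
    rw [real_inner_self_eq_norm_sq] at h1
    set c0 := inner ℝ (A g) g + inner ℝ (B g) g
    have hT : Tendsto (fun t : ℝ => (μ + 1) * t * ‖g‖ ^ 2 - t / 2 * c0) (𝓝[>] 0) (𝓝 0) := by
      have : Tendsto (fun t : ℝ => (μ + 1) * t * ‖g‖ ^ 2 - t / 2 * c0) (𝓝 0)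
          (𝓝 ((μ + 1) * 0 * ‖g‖ ^ 2 - 0 / 2 * c0)) :=
        Continuous.tendsto (by fun_prop) 0
      simp only [mul_zero, zero_mul, zero_div, sub_zero] at this
      exact this.mono_left nhdsWithin_le_nhds
    have h2 : ‖g‖ ^ 2 ≤ 0 := by
      refine ge_of_tendsto hT ?_
      filter_upwards [h1, self_mem_nhdsWithin] with t ht htpos
      have htpos : 0 < t := htpos
      have : t * ‖g‖ ^ 2 ≤ t * ((μ + 1) * t * ‖g‖ ^ 2 - t / 2 * c0) := by nlinarith
      exact le_of_mul_le_mul_left this htpos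
    linarith
  refine ⟨x, by linarith, ?_, p1, p2, A, B, hA, hB, ?_, ?_⟩
  · have h1 := hpm x₀
    simp only [hf, sub_self, norm_zero] at h1
    have h2 := real_inner_le_norm p (x₀ - x)
    rw [norm_sub_rev x₀ x] at h2
    have h3 : ‖p‖ * ‖x - x₀‖ ≤ μ * 1 := by
      apply mul_le_mul hp.le (by linarith) (norm_nonneg _) hμ.le
    have : 0 ≤ μ * ‖x - x₀‖ ^ 2 := by positivity
    nlinarith
  · have : p1 + p2 = P := sub_eq_zero.1 hgrad
    rw [this, hPdef]
    refine (norm_add_le _ _).trans ?_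
    rw [norm_smul, Real.norm_of_nonneg (by positivity)]
    have : 2 * μ * ‖x - x₀‖ ≤ 2 * μ * 1 := by gcongr; linarith
    linarith
  · intro h
    have h1 := hline h μ hμ
    rw [hgrad] at h1
    obtain ⟨t, ht, htpos⟩ := (h1.and self_mem_nhdsWithin).exists
    have htpos : 0 < t := htpos
    rw [inner_zero_left, mul_zero, zero_add] at ht
    have h2 : t ^ 2 * (inner ℝ (A h) h + inner ℝ (B h) h) ≤ t ^ 2 * (4 * μ * ‖h‖ ^ 2) := by
      nlinarith
    have h3 := le_of_mul_le_mul_left h2 (by positivity)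
    refine h3.trans ?_
    gcongr
    linarith

end Jensen

section Transfer

theorem ptJA' {E : Type*} [NormedAddCommGroup E] [InnerProductSpace ℝ E] [FiniteDimensional ℝ E]
    [MeasurableSpace E] [BorelSpace E] {a b : E → ℝ} {Λ : ℝ}
    (ha : ∀ x, ∃ s, ∀ y, a x + inner ℝ s (y - x) - Λ * ‖y - x‖ ^ 2 ≤ a y)
    (hb : ∀ x, ∃ s, ∀ y, b x + inner ℝ s (y - x) - Λ * ‖y - x‖ ^ 2 ≤ b y)
    (hΛ : 0 < Λ)
    (x₀ : E) (hmax : ∀ y, a y + b y ≤ a x₀ + b x₀) (δ : ℝ) (hδ : 0 < δ) :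
    ∃ x, ‖x - x₀‖ < δ ∧ a x₀ + b x₀ - δ ≤ a x + b x ∧ ∃ p q : E, ∃ A B : E →L[ℝ] E,
      (∀ᶠ h in 𝓝 0, a (x + h) ≤ a x + inner ℝ p h + (1 / 2) * inner ℝ (A h) h) ∧
      (∀ᶠ h in 𝓝 0, b (x + h) ≤ b x + inner ℝ q h + (1 / 2) * inner ℝ (B h) h) ∧
      ‖p + q‖ ≤ δ ∧ ∀ h, inner ℝ (A h) h + inner ℝ (B h) h ≤ δ * ‖h‖ ^ 2 := by
  obtain ⟨x, hx, hx2, p, q, A, B, hA, hB, hpq, hAB⟩ := ptJA ha hb hΛ x₀ hmax (δ / 8) (by positivity)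
  have aux : ∀ {a : E → ℝ} {p : E} {A : E →L[ℝ] E},
      (fun h => a (x + h) - a x - inner ℝ p h - (1 / 2) * inner ℝ (A h) h)
          =o[𝓝 0] (fun h : E => ‖h‖ ^ 2) →
      (∀ᶠ h in 𝓝 0, a (x + h) ≤ a x + inner ℝ p h +
        (1 / 2) * inner ℝ ((A + (δ / 4) • ContinuousLinearMap.id ℝ E) h) h) := by
    intro a p A h
    filter_upwards [Asymptotics.isLittleO_iff.1 h (show 0 < δ / 8 by positivity)] with h hh
    rw [Real.norm_eq_abs, Real.norm_of_nonneg (by positivity), abs_le] at hh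
    simp only [_root_.add_apply, _root_.smul_apply, ContinuousLinearMap.id_apply,
      inner_add_left, real_inner_smul_left, real_inner_self_eq_norm_sq]
    linarith [hh.2]
  refine ⟨x, by linarith, by linarith, p, q, _, _, aux hA, aux hB, by linarith, ?_⟩
  intro h
  simp only [_root_.add_apply, _root_.smul_apply, ContinuousLinearMap.id_apply,
      inner_add_left, real_inner_smul_left, real_inner_self_eq_norm_sq]
  have := hAB h
  have : 0 ≤ δ * ‖h‖ ^ 2 := by positivity
  linarith

theorem ptJAV {V : Type*} [NormedAddCommGroup V] [NormedSpace ℝ V] [FiniteDimensional ℝ V]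
    {a b : V → ℝ} {Λ : ℝ}
    (ha : ∀ x, ∃ s : V →L[ℝ] ℝ, ∀ y, a x + s (y - x) - Λ * ‖y - x‖ ^ 2 ≤ a y)
    (hb : ∀ x, ∃ s : V →L[ℝ] ℝ, ∀ y, b x + s (y - x) - Λ * ‖y - x‖ ^ 2 ≤ b y)
    (hΛ : 0 < Λ)
    (x₀ : V) (hmax : ∀ y, a y + b y ≤ a x₀ + b x₀) (δ : ℝ) (hδ : 0 < δ) :
    ∃ x, ‖x - x₀‖ < δ ∧ a x₀ + b x₀ - δ ≤ a x + b x ∧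
      ∃ p q : V →L[ℝ] ℝ, ∃ A B : V →L[ℝ] V →L[ℝ] ℝ,
      (∀ h k, A h k = A k h) ∧ (∀ h k, B h k = B k h) ∧
      (∀ᶠ h in 𝓝 0, a (x + h) ≤ a x + p h + (1 / 2) * A h h) ∧
      (∀ᶠ h in 𝓝 0, b (x + h) ≤ b x + q h + (1 / 2) * B h h) ∧
      (∀ h, |(p + q) h| ≤ δ * ‖h‖) ∧ ∀ h, A h h + B h h ≤ δ * ‖h‖ ^ 2 := by
  set E := EuclideanSpace ℝ (Fin (Module.finrank ℝ V))
  set T : V ≃L[ℝ] E := toEuclidean with hT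
  set C : ℝ := ‖(T : V →L[ℝ] E)‖ + 1 with hC
  have hCpos : 1 ≤ C := by
    have := norm_nonneg (T : V →L[ℝ] E)
    linarith
  have hTC : ∀ h, ‖T h‖ ≤ C * ‖h‖ := by
    intro h
    refine ((T : V →L[ℝ] E).le_opNorm h).trans ?_
    gcongr
    linarith
  set D : ℝ := ‖(T.symm : E →L[ℝ] V)‖ + 1 with hD
  have hDpos : 1 ≤ D := by
    have := norm_nonneg (T.symm : E →L[ℝ] V)
    linarith
  have hTD : ∀ h, ‖T.symm h‖ ≤ D * ‖h‖ := by
    intro h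
    refine ((T.symm : E →L[ℝ] V).le_opNorm h).trans ?_
    gcongr
    linarith
  have aux : ∀ {a : V → ℝ}
      (ha : ∀ x, ∃ s : V →L[ℝ] ℝ, ∀ y, a x + s (y - x) - Λ * ‖y - x‖ ^ 2 ≤ a y),
      ∀ x : E, ∃ s : E, ∀ y, a (T.symm x) + inner ℝ s (y - x) - (Λ * D ^ 2) * ‖y - x‖ ^ 2
        ≤ a (T.symm y) := by
    intro a ha x
    obtain ⟨s, hs⟩ := ha (T.symm x)
    refine ⟨(InnerProductSpace.toDual ℝ E).symm (s.comp (T.symm : E →L[ℝ] V)), fun y => ?_⟩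
    have h1 := hs (T.symm y)
    rw [← map_sub] at h1
    rw [InnerProductSpace.toDual_symm_apply]
    have h2 : ‖T.symm (y - x)‖ ^ 2 ≤ D ^ 2 * ‖y - x‖ ^ 2 := by
      rw [← mul_pow]
      gcongr
      exact hTD _
    have h3 := mul_le_mul_of_nonneg_left h2 hΛ.le
    simp only [ContinuousLinearMap.comp_apply, ContinuousLinearEquiv.coe_coe]
    linarith
  set δ' := δ / (2 * C ^ 2 * D) with hδ'
  have hδ'pos : 0 < δ' := by positivity
  have hδ1 : δ' * C ^ 2 * D = δ / 2 := by rw [hδ']; field_simp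
  have hge1 : 1 ≤ C ^ 2 := one_le_pow₀ hCpos
  have hδC2 : δ' * C ^ 2 ≤ δ := by nlinarith [mul_pos hδ'pos (show 0 < C ^ 2 by positivity)]
  have hδD : δ' * D < δ := by nlinarith [mul_pos hδ'pos (show 0 < D by positivity)]
  have hδC : δ' * C ≤ δ := by nlinarith [mul_pos hδ'pos (show 0 < C by positivity)]
  have hδδ : δ' ≤ δ := by nlinarith
  obtain ⟨x, hx, hx2, p, q, A, B, hA, hB, hpq, hAB⟩ := ptJA' (E := E) (aux ha) (aux hb)
    (by positivity) (T x₀) (by intro y; simpa using hmax (T.symm y)) δ' hδ'pos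
  have aux2 : ∀ {a : V → ℝ} {p : E} {A : E →L[ℝ] E},
      (∀ᶠ h in 𝓝 0, a (T.symm (x + h)) ≤ a (T.symm x) + inner ℝ p h + (1 / 2) * inner ℝ (A h) h) →
      (∀ᶠ h in 𝓝 (0 : V), a (T.symm x + h) ≤ a (T.symm x) + inner ℝ p (T h) +
        (1 / 2) * inner ℝ (A (T h)) (T h)) := by
    intro a p A h
    have ht : Tendsto (fun h : V => T h) (𝓝 0) (𝓝 0) := by
      have := T.continuous.tendsto 0
      rwa [map_zero] at this
    filter_upwards [ht.eventually h] with h hh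
    rw [map_add, ContinuousLinearEquiv.symm_apply_apply] at hh
    exact hh
  have hbilex : ∀ A : E →L[ℝ] E, ∃ M : V →L[ℝ] V →L[ℝ] ℝ, ∀ h k,
      M h k = 1 / 2 * (inner ℝ (A (T h)) (T k) + inner ℝ (A (T k)) (T h)) := by
    intro A
    refine ⟨LinearMap.toContinuousBilinearMap (LinearMap.mk₂ ℝ
      (fun h k => 1 / 2 * (inner ℝ (A (T h)) (T k) + inner ℝ (A (T k)) (T h)))
      ?_ ?_ ?_ ?_), fun h k => rfl⟩
    · intro m m' k; simp only [map_add, inner_add_left, inner_add_right]; ring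
    · intro c m k
      simp only [map_smul, real_inner_smul_left, real_inner_smul_right, smul_eq_mul]; ring
    · intro m m' k; simp only [map_add, inner_add_left, inner_add_right]; ring
    · intro c m k
      simp only [map_smul, real_inner_smul_left, real_inner_smul_right, smul_eq_mul]; ring
  choose bil hbil' using hbilex
  refine ⟨T.symm x, ?_, ?_, (innerSL ℝ p).comp (T : V →L[ℝ] E), (innerSL ℝ q).comp (T : V →L[ℝ] E),
    bil A, bil B, ?_, ?_, ?_, ?_, ?_, ?_⟩
  · have : T.symm x - x₀ = T.symm (x - T x₀) := by simp
    rw [this]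
    refine lt_of_le_of_lt (hTD _) ?_
    refine lt_of_le_of_lt ?_ hδD
    rw [mul_comm]
    gcongr
  · simp only [ContinuousLinearEquiv.symm_apply_apply] at hx2
    linarith
  · intro h k; rw [hbil', hbil']; ring
  · intro h k; rw [hbil', hbil']; ring
  · filter_upwards [aux2 hA] with h hh
    rw [hbil']
    simp only [ContinuousLinearMap.comp_apply, ContinuousLinearEquiv.coe_coe, innerSL_apply_apply]
    linarith
  · filter_upwards [aux2 hB] with h hh
    rw [hbil']
    simp only [ContinuousLinearMap.comp_apply, ContinuousLinearEquiv.coe_coe, innerSL_apply_apply]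
    linarith
  · intro h
    simp only [_root_.add_apply, ContinuousLinearMap.comp_apply, ContinuousLinearEquiv.coe_coe,
      innerSL_apply_apply]
    rw [← inner_add_left]
    refine (abs_real_inner_le_norm _ _).trans ?_
    calc _ ≤ δ' * (C * ‖h‖) := by gcongr; exact hTC h
      _ = δ' * C * ‖h‖ := by ring
      _ ≤ δ * ‖h‖ := by gcongr
  · intro h
    rw [hbil' A, hbil' B]
    have h1 := hAB (T h)
    have h2 : δ' * ‖T h‖ ^ 2 ≤ δ' * (C * ‖h‖) ^ 2 := by gcongr; exact hTC h
    have h3 : δ' * (C * ‖h‖) ^ 2 = δ' * C ^ 2 * ‖h‖ ^ 2 := by ring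
    have h4 : δ' * C ^ 2 * ‖h‖ ^ 2 ≤ δ * ‖h‖ ^ 2 := by gcongr
    linarith

end Transfer

section HeisGeom

variable {n : ℕ}

/-- Differential of the left translation by `ζ`. -/
def ptT (ζ : Heis n) : Heis n →L[ℝ] Heis n :=
  LinearMap.toContinuousLinearMap
    { toFun := fun h => (h.1, h.2.1, h.2.2 + 2 * ∑ i, (ζ.2.1 i * h.1 i - ζ.1 i * h.2.1 i))
      map_add' := by
        intro a b
        refine Prod.ext rfl (Prod.ext rfl ?_)
        simp only [Prod.fst_add, Prod.snd_add, Pi.add_apply]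
        have : ∀ i, ζ.2.1 i * (a.1 i + b.1 i) - ζ.1 i * (a.2.1 i + b.2.1 i)
          = (ζ.2.1 i * a.1 i - ζ.1 i * a.2.1 i) + (ζ.2.1 i * b.1 i - ζ.1 i * b.2.1 i) := by
          intro i; ring
        simp only [this, Finset.sum_add_distrib]
        ring
      map_smul' := by
        intro c a
        refine Prod.ext rfl (Prod.ext rfl ?_)
        simp only [Prod.smul_fst, Prod.smul_snd, Pi.smul_apply, smul_eq_mul, RingHom.id_apply]
        have : ∀ i, ζ.2.1 i * (c * a.1 i) - ζ.1 i * (c * a.2.1 i)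
          = c * (ζ.2.1 i * a.1 i - ζ.1 i * a.2.1 i) := by
          intro i; ring
        simp only [this, ← Finset.mul_sum]
        ring }

theorem ptT_apply (ζ h : Heis n) :
    ptT ζ h = (h.1, h.2.1, h.2.2 + 2 * ∑ i, (ζ.2.1 i * h.1 i - ζ.1 i * h.2.1 i)) := rfl

theorem ptCoord1 (h : Heis n) (i : Fin n) : |h.1 i| ≤ ‖h‖ :=
  (norm_le_pi_norm h.1 i).trans (norm_fst_le h)

theorem ptCoord2 (h : Heis n) (i : Fin n) : |h.2.1 i| ≤ ‖h‖ :=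
  (norm_le_pi_norm h.2.1 i).trans ((norm_fst_le h.2).trans (norm_snd_le h))

theorem ptCoord3 (h : Heis n) : |h.2.2| ≤ ‖h‖ :=
  (norm_snd_le h.2).trans (norm_snd_le h)

theorem ptNormLe (h : Heis n) (C : ℝ) (hC : 0 ≤ C) (h1 : ∀ i, |h.1 i| ≤ C)
    (h2 : ∀ i, |h.2.1 i| ≤ C) (h3 : |h.2.2| ≤ C) : ‖h‖ ≤ C := by
  rw [Prod.norm_def, Prod.norm_def]
  exact max_le ((pi_norm_le_iff_of_nonneg hC).2 h1)
    (max_le ((pi_norm_le_iff_of_nonneg hC).2 h2) h3)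

theorem ptT_norm (ζ h : Heis n) : ‖ptT ζ h‖ ≤ (1 + 4 * n * ‖ζ‖) * ‖h‖ := by
  have hc : 0 ≤ 4 * n * ‖ζ‖ * ‖h‖ := by positivity
  have h0 := norm_nonneg h
  apply ptNormLe
  · positivity
  · intro i; have := ptCoord1 h i; rw [ptT_apply]; simp only; linarith
  · intro i; have := ptCoord2 h i; rw [ptT_apply]; simp only; linarith
  · rw [ptT_apply]; simp only
    have h3 := ptCoord3 h
    have hs : |∑ i, (ζ.2.1 i * h.1 i - ζ.1 i * h.2.1 i)| ≤ ∑ _i : Fin n, 2 * (‖ζ‖ * ‖h‖) := by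
      refine (Finset.abs_sum_le_sum_abs _ _).trans (Finset.sum_le_sum fun i _ => ?_)
      refine (abs_sub _ _).trans ?_
      rw [abs_mul, abs_mul]
      have e1 := mul_le_mul (ptCoord2 ζ i) (ptCoord1 h i) (abs_nonneg _) (norm_nonneg _)
      have e2 := mul_le_mul (ptCoord1 ζ i) (ptCoord2 h i) (abs_nonneg _) (norm_nonneg _)
      linarith
    simp only [Finset.sum_const, Finset.card_univ, Fintype.card_fin, nsmul_eq_mul] at hs
    refine (abs_add_le _ _).trans ?_
    rw [abs_mul, abs_two]
    nlinarith

theorem pt_hmul_add (ζ η h : Heis n) : hmul ζ (η + h) = hmul ζ η + ptT ζ h := by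
  rw [ptT_apply]
  simp only [hmul]
  refine Prod.ext ?_ (Prod.ext ?_ ?_)
  · simp [add_assoc]
  · simp [add_assoc]
  · simp only [Prod.fst_add, Prod.snd_add, Pi.add_apply]
    have : ∀ i, ζ.2.1 i * (η.1 i + h.1 i) - ζ.1 i * (η.2.1 i + h.2.1 i)
          = (ζ.2.1 i * η.1 i - ζ.1 i * η.2.1 i) + (ζ.2.1 i * h.1 i - ζ.1 i * h.2.1 i) := by
      intro i; ring
    simp only [this, Finset.sum_add_distrib]
    ring

theorem pt_hmul_hinv_add (x h η : Heis n) :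
    hmul (x + h) (hinv η) = hmul x (hinv η) + ptT η h := by
  rw [ptT_apply]
  simp only [hmul, hinv]
  refine Prod.ext ?_ (Prod.ext ?_ ?_)
  · simp only [Prod.fst_add]; abel
  · simp only [Prod.fst_add, Prod.snd_add]; abel
  · simp only [Prod.fst_add, Prod.snd_add, Pi.add_apply, Pi.neg_apply]
    have : ∀ i, (x.2.1 i + h.2.1 i) * -η.1 i - (x.1 i + h.1 i) * -η.2.1 i
          = (x.2.1 i * -η.1 i - x.1 i * -η.2.1 i) + (η.2.1 i * h.1 i - η.1 i * h.2.1 i) := by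
      intro i; ring
    simp only [this, Finset.sum_add_distrib]
    ring

theorem pt_hmul_cancel (ζ η : Heis n) : hmul (hmul ζ η) (hinv η) = ζ := by
  simp only [hmul, hinv]
  refine Prod.ext ?_ (Prod.ext ?_ ?_)
  · simp
  · simp
  · simp only [Pi.add_apply, Pi.neg_apply]
    have : ∀ i, (ζ.2.1 i + η.2.1 i) * -η.1 i - (ζ.1 i + η.1 i) * -η.2.1 i
          = -(ζ.2.1 i * η.1 i - ζ.1 i * η.2.1 i) := by
      intro i; ring
    simp only [this, Finset.sum_neg_distrib]
    ring

theorem pt_hmul_cancel' (x η : Heis n) : hmul (hmul x (hinv η)) η = x := by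
  have := pt_hmul_cancel x (hinv η)
  have h2 : hinv (hinv η) = η := by simp [hinv]
  rwa [h2] at this

theorem pt_hmul_sub (ζ η : Heis n) : hmul ζ η - η = ptT (-η) ζ := by
  rw [ptT_apply]
  simp only [hmul]
  refine Prod.ext ?_ (Prod.ext ?_ ?_)
  · simp
  · simp
  · simp only [Prod.fst_neg, Prod.snd_neg, Prod.snd_sub, Pi.neg_apply]
    have : ∀ i, -η.2.1 i * ζ.1 i - -η.1 i * ζ.2.1 i = ζ.2.1 i * η.1 i - ζ.1 i * η.2.1 i := by
      intro i; ring
    simp only [this]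
    ring

theorem pt_vecField (ζ η : Heis n) (i : HIdx n) :
    ptT ζ (vecField i η) = vecField i (hmul ζ η) := by
  rw [ptT_apply]
  rcases i with i | i
  · simp only [vecField, hmul]
    refine Prod.ext rfl (Prod.ext rfl ?_)
    simp [Pi.single_apply]
    ring
  · simp only [vecField, hmul]
    refine Prod.ext rfl (Prod.ext rfl ?_)
    simp [Pi.single_apply]
    ring

/-- The quadratic gauge. -/
def ptQ (ζ : Heis n) : ℝ := zsq ζ + ζ.2.2 ^ 2

theorem zsq_nonneg' (ζ : Heis n) : 0 ≤ zsq ζ := by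
  unfold zsq; exact Finset.sum_nonneg fun i _ => by positivity

theorem zsq_le (ζ : Heis n) : zsq ζ ≤ 2 * n * ‖ζ‖ ^ 2 := by
  unfold zsq
  calc _ ≤ ∑ _i : Fin n, (‖ζ‖ ^ 2 + ‖ζ‖ ^ 2) := by
        refine Finset.sum_le_sum fun i _ => add_le_add ?_ ?_
        · exact sq_le_sq' (by linarith [(abs_le.1 (ptCoord1 ζ i)).1]) (abs_le.1 (ptCoord1 ζ i)).2
        · exact sq_le_sq' (by linarith [(abs_le.1 (ptCoord2 ζ i)).1]) (abs_le.1 (ptCoord2 ζ i)).2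
    _ = _ := by simp; ring

theorem ptQ_le (ζ : Heis n) : ptQ ζ ≤ (2 * n + 1) * ‖ζ‖ ^ 2 := by
  have h1 := zsq_le ζ
  have h2 : ζ.2.2 ^ 2 ≤ ‖ζ‖ ^ 2 :=
    sq_le_sq' (by linarith [(abs_le.1 (ptCoord3 ζ)).1]) (abs_le.1 (ptCoord3 ζ)).2
  unfold ptQ; linarith

theorem ptQ_ge (ζ : Heis n) : ‖ζ‖ ^ 2 ≤ ptQ ζ := by
  have hz := zsq_nonneg' ζ
  have hq : 0 ≤ ptQ ζ := by unfold ptQ; positivity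
  have : ‖ζ‖ ≤ Real.sqrt (ptQ ζ) := by
    apply ptNormLe _ _ (Real.sqrt_nonneg _)
    · intro i
      apply Real.abs_le_sqrt
      have : ζ.1 i ^ 2 + ζ.2.1 i ^ 2 ≤ zsq ζ :=
        Finset.single_le_sum (f := fun i => ζ.1 i ^ 2 + ζ.2.1 i ^ 2)
          (fun i _ => by positivity) (Finset.mem_univ i)
      unfold ptQ; nlinarith [sq_nonneg (ζ.2.1 i), sq_nonneg ζ.2.2]
    · intro i
      apply Real.abs_le_sqrt
      have : ζ.1 i ^ 2 + ζ.2.1 i ^ 2 ≤ zsq ζ :=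
        Finset.single_le_sum (f := fun i => ζ.1 i ^ 2 + ζ.2.1 i ^ 2)
          (fun i _ => by positivity) (Finset.mem_univ i)
      unfold ptQ; nlinarith [sq_nonneg (ζ.1 i), sq_nonneg ζ.2.2]
    · apply Real.abs_le_sqrt
      unfold ptQ; linarith
  calc ‖ζ‖ ^ 2 ≤ Real.sqrt (ptQ ζ) ^ 2 := by gcongr
    _ = _ := Real.sq_sqrt hq

theorem zsq_expand (η : Heis n) : ∃ s : Heis n →L[ℝ] ℝ,
    (∀ h, zsq (η + h) = zsq η + s h + zsq h) ∧
    ∀ h, s h = ∑ i, (2 * η.1 i * h.1 i + 2 * η.2.1 i * h.2.1 i) := by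
  refine ⟨LinearMap.toContinuousLinearMap
    { toFun := fun h => ∑ i, (2 * η.1 i * h.1 i + 2 * η.2.1 i * h.2.1 i)
      map_add' := ?_
      map_smul' := ?_ }, ?_, fun h => rfl⟩
  · intro a b
    rw [← Finset.sum_add_distrib]
    refine Finset.sum_congr rfl fun i _ => ?_
    simp only [Prod.fst_add, Prod.snd_add, Pi.add_apply]; ring
  · intro c a
    simp only [Prod.smul_fst, Prod.smul_snd, Pi.smul_apply, smul_eq_mul, RingHom.id_apply]
    rw [Finset.mul_sum]
    refine Finset.sum_congr rfl fun i _ => ?_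
    ring
  · intro h
    simp only [zsq, LinearMap.coe_toContinuousLinearMap', LinearMap.coe_mk, AddHom.coe_mk]
    rw [← Finset.sum_add_distrib, ← Finset.sum_add_distrib]
    refine Finset.sum_congr rfl fun i _ => ?_
    simp only [Prod.fst_add, Prod.snd_add, Pi.add_apply]; ring

theorem ptQ_expand (η : Heis n) : ∃ s : Heis n →L[ℝ] ℝ,
    ∀ h, ptQ (η + h) = ptQ η + s h + ptQ h := by
  obtain ⟨s, hs, -⟩ := zsq_expand η
  refine ⟨s + (2 * η.2.2) • ((ContinuousLinearMap.snd ℝ (Fin n → ℝ) ℝ).comp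
    (ContinuousLinearMap.snd ℝ (Fin n → ℝ) ((Fin n → ℝ) × ℝ))), fun h => ?_⟩
  simp only [ptQ, hs, _root_.add_apply, _root_.smul_apply, ContinuousLinearMap.comp_apply,
    ContinuousLinearMap.coe_snd', Prod.snd_add, smul_eq_mul]
  ring

/-- Sup-convolution. -/
theorem ptSupConv {V : Type*} [TopologicalSpace V] {K : Set V} (hK : IsCompact K)
    (hne : K.Nonempty) {U : V → ℝ} (hU : UpperSemicontinuousOn U K) {c : V → V → ℝ}
    (hc : ∀ x, Continuous (c x)) :
    ∃ a : V → ℝ, (∀ x, ∃ η ∈ K, a x = U η - c x η) ∧ (∀ x, ∀ η ∈ K, U η - c x η ≤ a x) := by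
  have : ∀ x, ∃ η ∈ K, ∀ η' ∈ K, U η' - c x η' ≤ U η - c x η := by
    intro x
    have h1 : UpperSemicontinuousOn (fun η => U η + (- c x η)) K :=
      hU.add ((hc x).neg.upperSemicontinuous.upperSemicontinuousOn K)
    obtain ⟨η, hη, hm⟩ := h1.exists_isMaxOn hne hK
    exact ⟨η, hη, fun η' h' => by simpa [sub_eq_add_neg] using hm h'⟩
  choose f hf hm using this
  exact ⟨fun x => U (f x) - c x (f x), fun x => ⟨f x, hf x, rfl⟩, fun x η hη => hm x η hη⟩

end HeisGeom

section Doubling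

variable {n : ℕ}

theorem ptKerCont (x : Heis n) : Continuous (fun η : Heis n => ptQ (hmul x (hinv η))) := by
  unfold ptQ zsq hmul hinv
  fun_prop

theorem ptKerCont2 : Continuous (fun q : Heis n × Heis n => ptQ (hmul q.1 (hinv q.2))) := by
  unfold ptQ zsq hmul hinv
  fun_prop

theorem ptSC {K : Set (Heis n)} {R j : ℝ} (hj : 0 ≤ j) (hK : ∀ η ∈ K, ‖η‖ ≤ R)
    {U a : Heis n → ℝ}
    (ha1 : ∀ x, ∃ η ∈ K, a x = U η - j * ptQ (hmul x (hinv η)))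
    (ha2 : ∀ x, ∀ η ∈ K, U η - j * ptQ (hmul x (hinv η)) ≤ a x) (x : Heis n) :
    ∃ s : Heis n →L[ℝ] ℝ, ∀ y,
      a x + s (y - x) - (j * ((2 * n + 1) * (1 + 4 * n * R) ^ 2)) * ‖y - x‖ ^ 2 ≤ a y := by
  obtain ⟨η, hη, hx⟩ := ha1 x
  obtain ⟨s, hs⟩ := ptQ_expand (hmul x (hinv η))
  refine ⟨(-j) • s.comp (ptT η), fun y => ?_⟩
  have h1 := ha2 y η hη
  have h2 : hmul y (hinv η) = hmul x (hinv η) + ptT η (y - x) := by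
    rw [← pt_hmul_hinv_add]; simp
  rw [h2, hs] at h1
  have h3 : ptQ (ptT η (y - x)) ≤ (2 * n + 1) * ((1 + 4 * n * R) * ‖y - x‖) ^ 2 := by
    refine (ptQ_le _).trans ?_
    gcongr
    refine (ptT_norm _ _).trans ?_
    gcongr
    exact hK η hη
  have h4 := mul_le_mul_of_nonneg_left h3 hj
  simp only [_root_.smul_apply, ContinuousLinearMap.comp_apply, smul_eq_mul]
  rw [hx]
  nlinarith

theorem ptDistKer {R : ℝ} {x η : Heis n} (hη : ‖η‖ ≤ R) :
    ‖x - η‖ ^ 2 ≤ (1 + 4 * n * R) ^ 2 * ptQ (hmul x (hinv η)) := by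
  have h1 := pt_hmul_sub (hmul x (hinv η)) η
  rw [pt_hmul_cancel'] at h1
  rw [h1]
  have h2 := ptT_norm (-η) (hmul x (hinv η))
  rw [norm_neg] at h2
  have h0 : 0 ≤ R := (norm_nonneg _).trans hη
  calc _ ≤ ((1 + 4 * n * R) * ‖hmul x (hinv η)‖) ^ 2 := by
        gcongr
        refine h2.trans ?_
        gcongr
    _ = (1 + 4 * n * R) ^ 2 * ‖hmul x (hinv η)‖ ^ 2 := by ring
    _ ≤ _ := by gcongr; exact ptQ_ge _

theorem ptQ_nonneg (ζ : Heis n) : 0 ≤ ptQ ζ := (sq_nonneg _).trans (ptQ_ge ζ)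

theorem ptJetTransfer {K : Set (Heis n)} {j : ℝ}
    {U a : Heis n → ℝ} {x η : Heis n} (hη : a x = U η - j * ptQ (hmul x (hinv η)))
    (ha2 : ∀ x, ∀ η ∈ K, U η - j * ptQ (hmul x (hinv η)) ≤ a x)
    {p : Heis n →L[ℝ] ℝ} {A : Heis n →L[ℝ] Heis n →L[ℝ] ℝ} (hA : ∀ h k, A h k = A k h)
    (hjet : ∀ᶠ h in 𝓝 0, a (x + h) ≤ a x + p h + (1 / 2) * A h h) :
    ∃ p' : Heis n →L[ℝ] ℝ, ∃ A' : Heis n →L[ℝ] Heis n →L[ℝ] ℝ, (∀ h k, A' h k = A' k h) ∧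
      (∀ᶠ h in 𝓝 0, η + h ∈ K → U (η + h) ≤ U η + p' h + (1 / 2) * A' h h) ∧
      (∀ i, p' (vecField i η) = p (vecField i x)) ∧
      (∀ i k, A' (vecField i η) (vecField k η) = A (vecField i x) (vecField k x)) := by
  set ζ := hmul x (hinv η) with hζ
  have hx : hmul ζ η = x := pt_hmul_cancel' x η
  refine ⟨p.comp (ptT ζ), A.bilinearComp (ptT ζ) (ptT ζ), ?_, ?_, ?_, ?_⟩
  · intro h k; simp only [ContinuousLinearMap.bilinearComp_apply]; exact hA _ _
  · have ht : Tendsto (fun h : Heis n => ptT ζ h) (𝓝 0) (𝓝 0) := by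
      have := (ptT ζ).continuous.tendsto 0
      rwa [map_zero] at this
    filter_upwards [ht.eventually hjet] with h hh hK
    have h1 := ha2 (hmul ζ (η + h)) (η + h) hK
    rw [pt_hmul_cancel, pt_hmul_add, hx] at h1
    simp only [ContinuousLinearMap.comp_apply, ContinuousLinearMap.bilinearComp_apply]
    linarith
  · intro i; simp only [ContinuousLinearMap.comp_apply]; rw [pt_vecField, hx]
  · intro i k; simp only [ContinuousLinearMap.bilinearComp_apply]
    rw [pt_vecField, pt_vecField, hx]

theorem pt_vecField_norm (i : HIdx n) (x : Heis n) : ‖vecField i x‖ ≤ 1 + 2 * ‖x‖ := by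
  have h0 := norm_nonneg x
  have hs : ∀ i k : Fin n, |(Pi.single i (1 : ℝ) : Fin n → ℝ) k| ≤ 1 := by
    intro i k
    by_cases h : k = i <;> simp [h]
  rcases i with i | i
  · apply ptNormLe _ _ (by positivity)
    · intro k; have := hs i k; simp only [vecField]; linarith
    · intro k; simp only [vecField, Pi.zero_apply, abs_zero]; positivity
    · have := ptCoord2 x i
      simp only [vecField, abs_mul, abs_two]; linarith
  · apply ptNormLe _ _ (by positivity)
    · intro k; simp only [vecField, Pi.zero_apply, abs_zero]; positivity
    · intro k; have := hs i k; simp only [vecField]; linarith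
    · have := ptCoord1 x i
      simp only [vecField, abs_neg, abs_mul, abs_two]; linarith

theorem ptBilSum {V ι : Type*} [Fintype ι] [NormedAddCommGroup V] [NormedSpace ℝ V]
    (A : V →L[ℝ] V →L[ℝ] ℝ) (f : ι → V) (e : ι → ℝ) :
    A (∑ i, e i • f i) (∑ i, e i • f i) = ∑ i, ∑ k, e i * e k * A (f i) (f k) := by
  simp only [map_sum, map_smul, _root_.sum_apply, _root_.smul_apply, smul_eq_mul,
    Finset.mul_sum]
  rw [Finset.sum_comm]
  refine Finset.sum_congr rfl fun i _ => Finset.sum_congr rfl fun k _ => ?_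
  ring

theorem ptMaxOn {V : Type*} [TopologicalSpace V] {K1 K2 P : Set V} (hK1 : IsCompact K1)
    (hK2 : IsCompact K2) (hP : IsCompact P) (hPne : P.Nonempty)
    {u1 u2 : V → ℝ} (hu1 : UpperSemicontinuousOn u1 K1) (hu2 : UpperSemicontinuousOn u2 K2)
    {c : V → V → ℝ} (hc : Continuous fun q : V × V => c q.1 q.2)
    (hne1 : K1.Nonempty) (hne2 : K2.Nonempty) {a b : V → ℝ}
    (ha1 : ∀ x, ∃ η ∈ K1, a x = u1 η - c x η) (ha2 : ∀ x, ∀ η ∈ K1, u1 η - c x η ≤ a x)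
    (hb1 : ∀ x, ∃ η ∈ K2, b x = u2 η - c x η) (hb2 : ∀ x, ∀ η ∈ K2, u2 η - c x η ≤ b x) :
    ∃ x₀, ∀ x ∈ P, a x + b x ≤ a x₀ + b x₀ := by
  have hUSC : UpperSemicontinuousOn (fun q : V × V × V =>
      u1 q.2.1 + u2 q.2.2 + (-(c q.1 q.2.1) - c q.1 q.2.2)) (P ×ˢ K1 ×ˢ K2) := by
    refine UpperSemicontinuousOn.add (UpperSemicontinuousOn.add ?_ ?_) ?_
    · exact hu1.comp (g := fun q : V × V × V => q.2.1) (by fun_prop)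
        (fun q hq => hq.2.1)
    · exact hu2.comp (g := fun q : V × V × V => q.2.2) (by fun_prop)
        (fun q hq => hq.2.2)
    · have c1 : Continuous fun q : V × V × V => c q.1 q.2.1 :=
        hc.comp (by fun_prop : Continuous fun q : V × V × V => (q.1, q.2.1))
      have c2 : Continuous fun q : V × V × V => c q.1 q.2.2 :=
        hc.comp (by fun_prop : Continuous fun q : V × V × V => (q.1, q.2.2))
      exact (c1.neg.sub c2).upperSemicontinuous.upperSemicontinuousOn _
  obtain ⟨⟨x₀, η₀, ζ₀⟩, hmem, hmx⟩ := hUSC.exists_isMaxOn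
    (hPne.prod (hne1.prod hne2)) (hP.prod (hK1.prod hK2))
  refine ⟨x₀, fun x hx => ?_⟩
  obtain ⟨η, hη, e1⟩ := ha1 x
  obtain ⟨ζ, hζ, e2⟩ := hb1 x
  have e3 := hmx (show (x, η, ζ) ∈ P ×ˢ K1 ×ˢ K2 from ⟨hx, hη, hζ⟩)
  simp only [Set.mem_ofPred_eq] at e3
  have e4 := ha2 x₀ η₀ hmem.2.1
  have e5 := hb2 x₀ ζ₀ hmem.2.2
  linarith

set_option maxHeartbeats 1000000 in
theorem ptDoubling {K1 K2 : Set (Heis n)} (hK1 : IsCompact K1) (hK2 : IsCompact K2)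
    {u1 u2 : Heis n → ℝ} (hu1 : UpperSemicontinuousOn u1 K1) (hu2 : UpperSemicontinuousOn u2 K2)
    {ξ0 : Heis n} (h1 : ξ0 ∈ K1) (h2 : ξ0 ∈ K2) {ε : ℝ} (hε : 0 < ε) :
    ∃ η ∈ K1, ∃ ζ ∈ K2, dist η ζ < ε ∧ u1 ξ0 + u2 ξ0 - ε ≤ u1 η + u2 ζ ∧
      ∃ p q : Heis n →L[ℝ] ℝ, ∃ A B : Heis n →L[ℝ] Heis n →L[ℝ] ℝ,
      (∀ h k, A h k = A k h) ∧ (∀ h k, B h k = B k h) ∧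
      (∀ᶠ h in 𝓝 0, η + h ∈ K1 → u1 (η + h) ≤ u1 η + p h + (1 / 2) * A h h) ∧
      (∀ᶠ h in 𝓝 0, ζ + h ∈ K2 → u2 (ζ + h) ≤ u2 ζ + q h + (1 / 2) * B h h) ∧
      (∀ i, |p (vecField i η) + q (vecField i ζ)| ≤ ε) ∧
      ∀ e : HIdx n → ℝ, ∑ i, ∑ k, e i * e k * (A (vecField i η) (vecField k η) +
        B (vecField i ζ) (vecField k ζ)) ≤ ε * ∑ i, e i ^ 2 := by
  obtain ⟨R1, hR1⟩ := hK1.isBounded.exists_norm_le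
  obtain ⟨R2, hR2⟩ := hK2.isBounded.exists_norm_le
  set R := max R1 R2 with hR
  have hb1 : ∀ η ∈ K1, ‖η‖ ≤ R := fun η h => (hR1 η h).trans (le_max_left _ _)
  have hb2 : ∀ η ∈ K2, ‖η‖ ≤ R := fun η h => (hR2 η h).trans (le_max_right _ _)
  have hR0 : 0 ≤ R := (norm_nonneg _).trans (hb1 ξ0 h1)
  set C1 : ℝ := 1 + 4 * n * R with hC1
  have hC1p : 1 ≤ C1 := by have : 0 ≤ 4 * n * R := by positivity
                           linarith
  obtain ⟨m1, hm1, hM1⟩ := hu1.exists_isMaxOn ⟨ξ0, h1⟩ hK1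
  obtain ⟨m2, hm2, hM2⟩ := hu2.exists_isMaxOn ⟨ξ0, h2⟩ hK2
  have hM1' : ∀ η ∈ K1, u1 η ≤ u1 m1 := fun η h => hM1 h
  have hM2' : ∀ η ∈ K2, u2 η ≤ u2 m2 := fun η h => hM2 h
  set N : ℝ := u1 m1 + u2 m2 - (u1 ξ0 + u2 ξ0) + 1 with hN
  have hN1 : 1 ≤ N := by linarith [hM1' ξ0 h1, hM2' ξ0 h2]
  set j : ℝ := N + 1 + C1 ^ 2 * N / (ε / 2) ^ 2 with hj
  have hjpos : 0 < j := by positivity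
  have hjN : N < j := by have : 0 ≤ C1 ^ 2 * N / (ε / 2) ^ 2 := by positivity
                         linarith
  have hjC : C1 ^ 2 * N < j * (ε / 2) ^ 2 := by
    have : C1 ^ 2 * N = C1 ^ 2 * N / (ε / 2) ^ 2 * (ε / 2) ^ 2 := by field_simp
    rw [this]
    apply mul_lt_mul_of_pos_right _ (by positivity)
    linarith
  obtain ⟨a, ha1, ha2⟩ := ptSupConv hK1 ⟨ξ0, h1⟩ hu1
    (c := fun x η => j * ptQ (hmul x (hinv η))) (fun x => (ptKerCont x).const_mul j |> fun h => h)
  obtain ⟨b, hb1', hb2'⟩ := ptSupConv hK2 ⟨ξ0, h2⟩ hu2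
    (c := fun x η => j * ptQ (hmul x (hinv η))) (fun x => (ptKerCont x).const_mul j |> fun h => h)
  have hq0 : ptQ (hmul ξ0 (hinv ξ0)) = 0 := by
    have : hmul ξ0 (hinv ξ0) = 0 := by
      have h := pt_hmul_cancel (0 : Heis n) ξ0
      have h' : hmul (0 : Heis n) ξ0 = ξ0 := by simp [hmul]
      rwa [h'] at h
    rw [this]; simp [ptQ, zsq]
  have ham : u1 ξ0 ≤ a ξ0 := by have := ha2 ξ0 ξ0 h1; simp only [hq0] at this; linarith
  have hbm : u2 ξ0 ≤ b ξ0 := by have := hb2' ξ0 ξ0 h2; simp only [hq0] at this; linarith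
  -- localization
  have hker1 : ∀ x, ∀ η ∈ K1, ptQ (hmul x (hinv η)) ≤ 1 → ‖x‖ ≤ R + C1 := by
    intro x η hη hq
    have e1 := ptDistKer (x := x) (hb1 η hη)
    have e2 : ‖x - η‖ ^ 2 ≤ C1 ^ 2 := e1.trans (by nlinarith)
    have e3 : ‖x - η‖ ≤ C1 := (le_abs_self _).trans (abs_le_of_sq_le_sq e2 (by linarith))
    have e4 : ‖x‖ ≤ ‖x - η‖ + ‖η‖ := by simpa using norm_add_le (x - η) η
    linarith [hb1 η hη]
  -- existence of a maximum
  have hmaxex : ∃ x₀, ∀ y, a y + b y ≤ a x₀ + b x₀ := by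
    obtain ⟨x₀, hmx'⟩ := ptMaxOn hK1 hK2 (isCompact_closedBall (0 : Heis n) (R + C1))
      ⟨ξ0, by simp only [Metric.mem_closedBall, dist_zero_right]; linarith [hb1 ξ0 h1]⟩ hu1 hu2
      (ptKerCont2.const_mul j) ⟨ξ0, h1⟩ ⟨ξ0, h2⟩ ha1 ha2 hb1' hb2'
    refine ⟨x₀, fun y => ?_⟩
    by_cases hy : y ∈ Metric.closedBall (0 : Heis n) (R + C1)
    · exact hmx' y hy
    · have e0 := hmx' ξ0 (by simp only [Metric.mem_closedBall, dist_zero_right]; linarith [hb1 ξ0 h1])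
      obtain ⟨η, hη, e1⟩ := ha1 y
      obtain ⟨ζ, hζ, e2⟩ := hb1' y
      have e3 : 1 < ptQ (hmul y (hinv η)) := by
        by_contra hc
        push Not at hc
        apply hy
        simp only [Metric.mem_closedBall, dist_zero_right]
        exact hker1 y η hη hc
      have e4 : j ≤ j * ptQ (hmul y (hinv η)) := by nlinarith
      have e5 : 0 ≤ j * ptQ (hmul y (hinv ζ)) := mul_nonneg hjpos.le (ptQ_nonneg _)
      linarith [hM1' η hη, hM2' ζ hζ]
  obtain ⟨x₀, hmax⟩ := hmaxex
  set C2 : ℝ := 1 + 2 * (R + C1) with hC2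
  have hC2p : 1 ≤ C2 := by linarith
  set δ := min 1 (ε / (C2 ^ 2 * (2 * n + 1))) with hδ
  have hδpos : 0 < δ := by positivity
  have hδ1 : δ ≤ 1 := min_le_left _ _
  have hδ2 : δ * (C2 ^ 2 * (2 * n + 1)) ≤ ε := by
    have : δ ≤ ε / (C2 ^ 2 * (2 * n + 1)) := min_le_right _ _
    rwa [le_div_iff₀ (by positivity)] at this
  have hn0 : (0 : ℝ) ≤ n := Nat.cast_nonneg n
  have hC22 : C2 ≤ C2 ^ 2 := by nlinarith
  have hδ3 : δ * C2 ≤ ε := by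
    refine le_trans ?_ hδ2
    gcongr
    nlinarith [sq_nonneg C2]
  have hδ4 : δ ≤ ε := by nlinarith
  obtain ⟨x, -, hx2, p, q, A, B, hA, hB, hja, hjb, hpq, hAB⟩ := ptJAV
    (Λ := j * ((2 * n + 1) * (1 + 4 * n * R) ^ 2))
    (fun x => ptSC hjpos.le hb1 ha1 ha2 x) (fun x => ptSC hjpos.le hb2 hb1' hb2' x)
    (by positivity) x₀ hmax δ hδpos
  obtain ⟨η, hη, e1⟩ := ha1 x
  obtain ⟨ζ, hζ, e2⟩ := hb1' x
  have hsum : u1 ξ0 + u2 ξ0 - δ ≤ a x + b x := by linarith [hmax ξ0]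
  have q1 := mul_nonneg hjpos.le (ptQ_nonneg (hmul x (hinv η)))
  have q2 := mul_nonneg hjpos.le (ptQ_nonneg (hmul x (hinv ζ)))
  have f1 : j * ptQ (hmul x (hinv η)) ≤ N := by linarith [hM1' η hη, hM2' ζ hζ]
  have f2 : j * ptQ (hmul x (hinv ζ)) ≤ N := by linarith [hM1' η hη, hM2' ζ hζ]
  have f3 : ptQ (hmul x (hinv η)) ≤ 1 := by
    by_contra hc
    push Not at hc
    nlinarith
  have hxn := hker1 x η hη f3
  have hclose : ∀ {θ : Heis n}, ‖θ‖ ≤ R → j * ptQ (hmul x (hinv θ)) ≤ N → ‖x - θ‖ < ε / 2 := by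
    intro θ hθ hq
    have g1 := ptDistKer (x := x) hθ
    have g2 : j * ‖x - θ‖ ^ 2 < j * (ε / 2) ^ 2 := by
      refine lt_of_le_of_lt ?_ hjC
      calc _ ≤ j * (C1 ^ 2 * ptQ (hmul x (hinv θ))) := by gcongr
        _ = C1 ^ 2 * (j * ptQ (hmul x (hinv θ))) := by ring
        _ ≤ _ := by gcongr
    have g3 := lt_of_mul_lt_mul_left g2 hjpos.le
    exact lt_of_pow_lt_pow_left₀ 2 (by positivity) g3
  obtain ⟨p', A', hA', hj1, hp', hAA⟩ := ptJetTransfer e1 ha2 hA hja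
  obtain ⟨q', B', hB', hj2, hq', hBB⟩ := ptJetTransfer e2 hb2' hB hjb
  have hVn : ∀ i, ‖vecField i x‖ ≤ C2 := by
    intro i
    refine (pt_vecField_norm i x).trans ?_
    linarith
  refine ⟨η, hη, ζ, hζ, ?_, by linarith, p', q', A', B', hA', hB', hj1, hj2, ?_, ?_⟩
  · have g1 := hclose (hb1 η hη) f1
    have g2 := hclose (hb2 ζ hζ) f2
    have g3 := dist_triangle_left η ζ x
    rw [dist_eq_norm x η, dist_eq_norm x ζ] at g3
    linarith
  · intro i
    rw [hp', hq', ← _root_.add_apply]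
    refine (hpq _).trans ?_
    calc _ ≤ δ * C2 := by gcongr; exact hVn i
      _ ≤ ε := hδ3
  · intro e
    simp only [hAA, hBB]
    have g1 := ptBilSum (A + B) (fun i : HIdx n => vecField i x) e
    simp only [_root_.add_apply] at g1
    rw [← g1]
    refine (hAB _).trans ?_
    have g2 : ‖∑ i, e i • vecField i x‖ ≤ C2 * ∑ i, |e i| := by
      refine (norm_sum_le _ _).trans ?_
      rw [Finset.mul_sum]
      refine Finset.sum_le_sum fun i _ => ?_
      rw [norm_smul, Real.norm_eq_abs, mul_comm]
      gcongr
      exact hVn i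
    have g3 : (∑ i, |e i|) ^ 2 ≤ (2 * n) * ∑ i, e i ^ 2 := by
      have := sq_sum_le_card_mul_sum_sq (s := (Finset.univ : Finset (HIdx n))) (f := fun i => |e i|)
      simp only [sq_abs, Finset.card_univ, Fintype.card_sum, Fintype.card_fin, Nat.cast_add] at this
      linarith
    have g4 : 0 ≤ ∑ i, e i ^ 2 := Finset.sum_nonneg fun i _ => sq_nonneg _
    calc _ ≤ δ * (C2 * ∑ i, |e i|) ^ 2 := by gcongr
      _ = δ * C2 ^ 2 * (∑ i, |e i|) ^ 2 := by ring
      _ ≤ δ * C2 ^ 2 * ((2 * n) * ∑ i, e i ^ 2) := by gcongr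
      _ ≤ δ * C2 ^ 2 * ((2 * n + 1) * ∑ i, e i ^ 2) := by gcongr; linarith
      _ = δ * (C2 ^ 2 * (2 * n + 1)) * ∑ i, e i ^ 2 := by ring
      _ ≤ _ := by gcongr

end Doubling

section MatCalc

variable {n : ℕ}

/-- Quadratic form of a matrix. -/
def ptqf (M : HMat n) (e : HIdx n → ℝ) : ℝ := ∑ i, ∑ k, e i * e k * M i k

/-- Euclidean dot product. -/
def ptdot (p e : HIdx n → ℝ) : ℝ := ∑ i, p i * e i

/-- The quadratic form of the lower order term. -/
def ptLf (a b c : ℝ) (p e : HIdx n → ℝ) : ℝ :=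
  a * ptdot p e ^ 2 - c * ptdot (Jmat n *ᵥ p) e ^ 2 - b * ptdot p p * ptdot e e

theorem ptqf_add (M N : HMat n) (e : HIdx n → ℝ) : ptqf (M + N) e = ptqf M e + ptqf N e := by
  simp only [ptqf, Matrix.add_apply, mul_add, Finset.sum_add_distrib]

theorem ptqf_sub (M N : HMat n) (e : HIdx n → ℝ) : ptqf (M - N) e = ptqf M e - ptqf N e := by
  simp only [ptqf, Matrix.sub_apply, mul_sub, Finset.sum_sub_distrib]

theorem ptqf_smul (c : ℝ) (M : HMat n) (e : HIdx n → ℝ) : ptqf (c • M) e = c * ptqf M e := by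
  simp only [ptqf, Matrix.smul_apply, smul_eq_mul, Finset.mul_sum]
  refine Finset.sum_congr rfl fun i _ => Finset.sum_congr rfl fun k _ => ?_
  ring

theorem ptqf_vec (p e : HIdx n → ℝ) : ptqf (vecMulVec p p) e = ptdot p e ^ 2 := by
  simp only [ptqf, vecMulVec_apply, ptdot, sq, Finset.sum_mul_sum]
  refine Finset.sum_congr rfl fun i _ => Finset.sum_congr rfl fun k _ => ?_
  ring

theorem ptqf_one (e : HIdx n → ℝ) : ptqf (1 : HMat n) e = ptdot e e := by
  simp only [ptqf, ptdot, Matrix.one_apply, mul_ite, mul_one, mul_zero, Finset.sum_ite_eq,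
    Finset.mem_univ, if_true]

theorem ptqf_L (α β γ : Heis n → ℝ → ℝ) (ξ : Heis n) (s : ℝ) (p e : HIdx n → ℝ) :
    ptqf (Lquad α β γ ξ s p) e = ptLf (α ξ s) (β ξ s) (γ ξ s) p e := by
  simp only [Lquad, ptqf_sub, ptqf_smul, ptqf_vec, ptqf_one, ptLf]
  have : ∑ j, p j ^ 2 = ptdot p p := by simp [ptdot, sq]
  rw [this]

theorem ptqf_dot (M : HMat n) (e : HIdx n → ℝ) : star e ⬝ᵥ (M *ᵥ e) = ptqf M e := by
  simp only [ptqf, dotProduct, mulVec, Pi.star_apply, star_trivial, Finset.mul_sum]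
  refine Finset.sum_congr rfl fun i _ => Finset.sum_congr rfl fun k _ => ?_
  ring

theorem ptqf_matLE {M N : HMat n} (h : matLE M N) (e : HIdx n → ℝ) : ptqf M e ≤ ptqf N e := by
  have := h.dotProduct_mulVec_nonneg e
  rw [ptqf_dot, ptqf_sub] at this
  linarith

theorem ptdot_smul (c : ℝ) (p e : HIdx n → ℝ) : ptdot (c • p) e = c * ptdot p e := by
  simp only [ptdot, Pi.smul_apply, smul_eq_mul, Finset.mul_sum, mul_assoc]

theorem ptdot_add (p q e : HIdx n → ℝ) : ptdot (p + q) e = ptdot p e + ptdot q e := by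
  simp only [ptdot, Pi.add_apply, add_mul, Finset.sum_add_distrib]

theorem ptdot_comm (p e : HIdx n → ℝ) : ptdot p e = ptdot e p := by
  simp only [ptdot, mul_comm]

theorem ptdot_nonneg (e : HIdx n → ℝ) : 0 ≤ ptdot e e :=
  Finset.sum_nonneg fun i _ => mul_self_nonneg _

theorem ptdot_cs (p e : HIdx n → ℝ) : ptdot p e ^ 2 ≤ ptdot p p * ptdot e e := by
  have := Finset.sum_mul_sq_le_sq_mul_sq Finset.univ p e
  simp only [ptdot, ← sq]
  exact this

theorem ptJ_apply (p : HIdx n → ℝ) : (∀ i, (Jmat n *ᵥ p) (Sum.inl i) = p (Sum.inr i)) ∧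
    (∀ i, (Jmat n *ᵥ p) (Sum.inr i) = - p (Sum.inl i)) := by
  constructor <;> intro k <;> simp [mulVec, dotProduct, Jmat]

theorem ptJ_norm (p : HIdx n → ℝ) : ptdot (Jmat n *ᵥ p) (Jmat n *ᵥ p) = ptdot p p := by
  obtain ⟨h1, h2⟩ := ptJ_apply p
  simp only [ptdot, Fintype.sum_sum_type, h1, h2]
  rw [add_comm]
  simp

theorem ptLf_smul (a b c t : ℝ) (p e : HIdx n → ℝ) : ptLf a b c (t • p) e = t ^ 2 * ptLf a b c p e := by
  have : ptdot (t • p) (t • p) = t ^ 2 * ptdot p p := by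
    rw [ptdot_smul, ptdot_comm, ptdot_smul]; ring
  simp only [ptLf, mulVec_smul, this, ptdot_smul]
  ring

theorem ptL_symm (α β γ : Heis n → ℝ → ℝ) (ξ : Heis n) (s : ℝ) (p : HIdx n → ℝ) :
    (Lquad α β γ ξ s p).IsSymm := by
  have hv : ∀ q : HIdx n → ℝ, (vecMulVec q q).IsSymm := by
    intro q; ext i k; simp [vecMulVec_apply, mul_comm]
  unfold Lquad
  exact (((hv p).smul _).sub ((hv _).smul _)).sub (Matrix.isSymm_one.smul _)

theorem ptHs_symm (φ : Heis n → ℝ) (ξ : Heis n) : (hHessSym φ ξ).IsSymm := by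
  unfold hHessSym
  exact (Matrix.isSymm_add_transpose_self _).smul _

theorem ptF_symm (α β γ : Heis n → ℝ → ℝ) (φ : Heis n → ℝ) (ξ : Heis n) :
    (Fop (Lquad α β γ) φ ξ).IsSymm :=
  (ptHs_symm φ ξ).add (ptL_symm α β γ ξ _ _)

theorem ptMatLemma {S : Set (HMat n)} (hSsymm : ∀ A ∈ S, A.IsSymm)
    (hSpos : ∀ A ∈ S, ∀ B : HMat n, B.PosDef → A + B ∈ S) {M1 M2 : HMat n}
    (h1 : M1 ∈ closure S) (h2 : M2.IsSymm) {c : ℝ} (hc : 0 < c)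
    (h : ∀ e, c * ptdot e e ≤ ptqf M2 e - ptqf M1 e) : M2 ∈ S := by
  have hd : 0 < c / (2 * n + 1) := by positivity
  set O : Set (HMat n) := {A | ∀ i k, |A i k - M1 i k| < c / (2 * n + 1)} with hO
  have hOo : IsOpen O := by
    simp only [hO, Set.ofPred_forall]
    refine isOpen_iInter_of_finite fun i => isOpen_iInter_of_finite fun k => ?_
    exact isOpen_lt (by fun_prop) continuous_const
  obtain ⟨A, hAO, hAS⟩ := mem_closure_iff.1 h1 O hOo (by intro i k; simpa using hd)
  have hM : M2 = A + (M2 - A) := by abel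
  rw [hM]
  refine hSpos A hAS _ (Matrix.PosDef.of_dotProduct_mulVec_pos ?_ ?_)
  · have := h2.sub (hSsymm A hAS)
    exact this
  · intro e he
    rw [ptqf_dot, ptqf_sub]
    have e1 := h e
    have e2 : ptqf A e - ptqf M1 e ≤ c / (2 * n + 1) * (2 * n * ptdot e e) := by
      have g3 : (∑ i, |e i|) ^ 2 ≤ (2 * n) * ptdot e e := by
        have := sq_sum_le_card_mul_sum_sq (s := (Finset.univ : Finset (HIdx n))) (f := fun i => |e i|)
        simp only [sq_abs, Finset.card_univ, Fintype.card_sum, Fintype.card_fin, Nat.cast_add] at this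
        simp only [ptdot, ← sq]
        linarith
      calc _ = ∑ i, ∑ k, e i * e k * (A i k - M1 i k) := by
            rw [← ptqf_sub]; rfl
        _ ≤ ∑ i, ∑ k, c / (2 * n + 1) * (|e i| * |e k|) := by
            refine Finset.sum_le_sum fun i _ => Finset.sum_le_sum fun k _ => ?_
            refine (le_abs_self _).trans ?_
            rw [abs_mul, abs_mul, mul_comm]
            exact mul_le_mul_of_nonneg_right (hAO i k).le (by positivity)
        _ = c / (2 * n + 1) * (∑ i, |e i|) ^ 2 := by
            rw [sq, Finset.sum_mul_sum, Finset.mul_sum]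
            refine Finset.sum_congr rfl fun i _ => ?_
            rw [Finset.mul_sum]
        _ ≤ _ := by gcongr
    have e3 : 0 < ptdot e e := by
      obtain ⟨i, hi⟩ := Function.ne_iff.1 he
      refine Finset.sum_pos' (fun i _ => mul_self_nonneg _) ⟨i, Finset.mem_univ _, ?_⟩
      exact mul_self_pos.2 hi
    have e4 : c / (2 * n + 1) * (2 * n * ptdot e e) = c * ptdot e e - c / (2 * n + 1) * ptdot e e := by
      field_simp; ring
    have e5 : 0 < c / (2 * n + 1) * ptdot e e := by positivity
    linarith

/-- Linear part of the (affine) vector fields. -/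
def ptl (i : HIdx n) : Heis n →L[ℝ] Heis n :=
  LinearMap.toContinuousLinearMap
    (match i with
    | Sum.inl i =>
      { toFun := fun h => (0, 0, 2 * h.2.1 i)
        map_add' := by intro a b; simp [mul_add]
        map_smul' := by intro a b; simp; ring }
    | Sum.inr i =>
      { toFun := fun h => (0, 0, -(2 * h.1 i))
        map_add' := by intro a b; simp [mul_add]; ring
        map_smul' := by intro a b; simp; ring })

theorem ptl_spec (i : HIdx n) (x h : Heis n) : vecField i (x + h) = vecField i x + ptl i h := by
  rcases i with i | i <;> simp [vecField, ptl] <;> ring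

theorem ptl_anti (i k : HIdx n) (x : Heis n) :
    ptl i (vecField k x) + ptl k (vecField i x) = 0 := by
  rcases i with i | i <;> rcases k with k | k <;>
    simp [vecField, ptl, Pi.single_apply, eq_comm] <;> rfl

theorem ptl_deriv (i : HIdx n) (x : Heis n) : HasFDerivAt (vecField i) (ptl i) x := by
  have h : vecField i = fun y => vecField i 0 + ptl i y := by
    funext y; rw [← ptl_spec, zero_add]
  rw [h]
  exact (ptl i).hasFDerivAt.const_add _

/-- Quadratic polynomial. -/
def ptquad (η : Heis n) (c : ℝ) (p : Heis n →L[ℝ] ℝ) (A : Heis n →L[ℝ] Heis n →L[ℝ] ℝ)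
    (y : Heis n) : ℝ := c + p (y - η) + (1 / 2) * A (y - η) (y - η)

theorem ptquad_contDiff (η : Heis n) (c : ℝ) (p : Heis n →L[ℝ] ℝ)
    (A : Heis n →L[ℝ] Heis n →L[ℝ] ℝ) : ContDiff ℝ 2 (ptquad η c p A) := by
  unfold ptquad
  have h0 : ContDiff ℝ 2 (fun y : Heis n => y - η) := contDiff_id.sub contDiff_const
  have h1 : ContDiff ℝ 2 (fun y : Heis n => A (y - η)) := A.contDiff.comp h0
  exact (contDiff_const.add (p.contDiff.comp h0)).add (contDiff_const.mul (h1.clm_apply h0))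

theorem ptquad_deriv (η : Heis n) (c : ℝ) (p : Heis n →L[ℝ] ℝ)
    (A : Heis n →L[ℝ] Heis n →L[ℝ] ℝ) (hA : ∀ h k, A h k = A k h) (y : Heis n) :
    HasFDerivAt (ptquad η c p A) (p + A (y - η)) y := by
  have h0 : HasFDerivAt (fun y : Heis n => y - η) (ContinuousLinearMap.id ℝ (Heis n)) y :=
    (hasFDerivAt_id y).sub_const η
  have h1 : HasFDerivAt (fun y : Heis n => A (y - η)) A y := A.hasFDerivAt.comp y h0
  have h2 := ((p.hasFDerivAt.comp y h0).const_add c).add ((h1.clm_apply h0).const_mul (1 / 2))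
  refine h2.congr_fderiv ?_
  refine ContinuousLinearMap.ext fun h => ?_
  simp only [_root_.add_apply, _root_.smul_apply, ContinuousLinearMap.comp_apply,
    ContinuousLinearMap.id_apply, ContinuousLinearMap.flip_apply, smul_eq_mul, hA h (y - η)]
  ring

theorem ptTest (η : Heis n) (c : ℝ) (p : Heis n →L[ℝ] ℝ)
    (A : Heis n →L[ℝ] Heis n →L[ℝ] ℝ) (hA : ∀ h k, A h k = A k h) {g g1 : ℝ → ℝ} {g2 : ℝ}
    (hg : ∀ s, HasDerivAt g (g1 s) s) (hg1 : HasDerivAt g1 g2 c) :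
    (∀ i, hGrad (fun y => g (ptquad η c p A y)) η i = g1 c * p (vecField i η)) ∧
    ∀ i k, hHessSym (fun y => g (ptquad η c p A y)) η i k =
      g2 * (p (vecField i η) * p (vecField k η)) + g1 c * A (vecField i η) (vecField k η) := by
  have hq0 : ptquad η c p A η = c := by simp [ptquad]
  have hd : ∀ y, HasFDerivAt (fun y => g (ptquad η c p A y))
      (g1 (ptquad η c p A y) • (p + A (y - η))) y :=
    fun y => (hg _).comp_hasFDerivAt y (ptquad_deriv η c p A hA y)
  have hH : ∀ i k, hHess (fun y => g (ptquad η c p A y)) η i k =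
      g2 * (p (vecField i η) * p (vecField k η)) + g1 c * (A (vecField i η) (vecField k η)
        + p (ptl i (vecField k η))) := by
    intro i k
    simp only [hHess, Matrix.of_apply]
    have hfun : (fun y => fderiv ℝ (fun y => g (ptquad η c p A y)) y (vecField i y)) =
        fun y => g1 (ptquad η c p A y) * ((p + A (y - η)) (vecField i y)) := by
      funext y
      rw [(hd y).fderiv]; simp only [_root_.smul_apply, smul_eq_mul]
    rw [hfun]
    have h0 : HasFDerivAt (fun y : Heis n => y - η) (ContinuousLinearMap.id ℝ (Heis n)) η :=
      (hasFDerivAt_id η).sub_const η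
    have h1 : HasFDerivAt (fun y : Heis n => p + A (y - η)) A η :=
      (A.hasFDerivAt.comp η h0).const_add p
    have h2 := h1.clm_apply (ptl_deriv i η)
    have h3 : HasFDerivAt (fun y => g1 (ptquad η c p A y)) (g2 • (p + A (η - η))) η := by
      rw [← hq0] at hg1
      exact hg1.comp_hasFDerivAt η (ptquad_deriv η c p A hA η)
    have h4 : HasFDerivAt (fun y => g1 (ptquad η c p A y) * (p + A (y - η)) (vecField i y)) _ η :=
      h3.mul h2
    rw [h4.fderiv]
    simp [hq0, hA (vecField k η)]
    ring
  constructor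
  · intro i
    simp only [hGrad, (hd η).fderiv, hq0]
    simp
  · intro i k
    simp only [hHessSym, Matrix.smul_apply, Matrix.add_apply, Matrix.transpose_apply, hH, smul_eq_mul]
    have h1 : p (ptl i (vecField k η)) + p (ptl k (vecField i η)) = 0 := by
      rw [← map_add, ptl_anti, map_zero]
    rw [hA (vecField k η) (vecField i η)]
    linear_combination (1 / 2 * g1 c) * h1

end MatCalc

section Visc

variable {n : ℕ}

theorem ptSub {Ω : Set (Heis n)} {α β γ : Heis n → ℝ → ℝ} {S : Set (HMat n)}
    {v : Heis n → EReal} (hsub : IsSubsolution Ω (Lquad α β γ) S v)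
    (hScone : ∀ A ∈ S, ∀ c : ℝ, 0 < c → c • A ∈ S) {η : Heis n} (hη : η ∈ Ω) {c : ℝ}
    {p : Heis n →L[ℝ] ℝ} {A : Heis n →L[ℝ] Heis n →L[ℝ] ℝ} (hA : ∀ h k, A h k = A k h)
    {g g1 : ℝ → ℝ} {g2 : ℝ} (hgc : ContDiff ℝ 2 g)
    (hg : ∀ s, HasDerivAt g (g1 s) s) (hg1 : HasDerivAt g1 g2 c) (hpos : 0 < g1 c)
    (hv : v η = ((g c : ℝ) : EReal))
    (hle : ∀ᶠ h in 𝓝 (0 : Heis n), η + h ∈ Ω →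
      v (η + h) ≤ ((g (c + p h + (1 / 2) * A h h) : ℝ) : EReal)) :
    ∃ M1 ∈ closure S, ∀ e, ptqf M1 e = g2 / g1 c * ptdot (fun i => p (vecField i η)) e ^ 2
      + ∑ i, ∑ k, e i * e k * A (vecField i η) (vecField k η)
      + g1 c * ptLf (α η (g c)) (β η (g c)) (γ η (g c)) (fun i => p (vecField i η)) e := by
  have hq0 : ptquad η c p A η = c := by simp [ptquad]
  obtain ⟨t1, t2⟩ := ptTest η c p A hA hg hg1
  have hF := hsub η hη (fun y => g (ptquad η c p A y))
    (hgc.comp (ptquad_contDiff η c p A)).contDiffOn (by simp only [hq0]; exact hv) (by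
      have ht : Tendsto (fun y : Heis n => y - η) (𝓝 η) (𝓝 0) := by
        have : Continuous fun y : Heis n => y - η := by fun_prop
        simpa using this.tendsto η
      filter_upwards [ht.eventually hle] with y hy hyΩ
      simp only [add_sub_cancel] at hy
      exact hy hyΩ)
  refine ⟨(g1 c)⁻¹ • Fop (Lquad α β γ) (fun y => g (ptquad η c p A y)) η, ?_, ?_⟩
  · refine map_mem_closure (f := fun M : HMat n => (g1 c)⁻¹ • M) (by fun_prop) hF ?_
    intro M hM
    exact hScone M hM _ (by positivity)
  · intro e
    have hG : hGrad (fun y => g (ptquad η c p A y)) η = g1 c • (fun i => p (vecField i η)) := by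
      funext i; rw [t1]; rfl
    have hS : ptqf (hHessSym (fun y => g (ptquad η c p A y)) η) e =
        g2 * ptdot (fun i => p (vecField i η)) e ^ 2 +
        g1 c * ∑ i, ∑ k, e i * e k * A (vecField i η) (vecField k η) := by
      have hdd : ptdot (fun i => p (vecField i η)) e ^ 2 =
          ∑ i, ∑ k, (p (vecField i η) * e i) * (p (vecField k η) * e k) := by
        rw [ptdot, sq, Finset.sum_mul_sum]
      rw [hdd]
      simp only [ptqf, t2, Finset.mul_sum]
      simp only [← Finset.sum_add_distrib]
      refine Finset.sum_congr rfl fun i _ => Finset.sum_congr rfl fun k _ => ?_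
      ring
    rw [ptqf_smul]
    unfold Fop
    rw [ptqf_add, ptqf_L, hG, ptLf_smul, hS]
    simp only [hq0]
    field_simp

theorem ptSuper {Ω : Set (Heis n)} {α β γ : Heis n → ℝ → ℝ} {S : Set (HMat n)}
    {w : Heis n → EReal} (hsup : IsSupersolution Ω (Lquad α β γ) S w)
    {η : Heis n} (hη : η ∈ Ω) {c : ℝ}
    {p : Heis n →L[ℝ] ℝ} {A : Heis n →L[ℝ] Heis n →L[ℝ] ℝ} (hA : ∀ h k, A h k = A k h)
    (hv : w η = ((c : ℝ) : EReal))
    (hle : ∀ᶠ h in 𝓝 (0 : Heis n), η + h ∈ Ω →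
      (((c + p h + (1 / 2) * A h h : ℝ)) : EReal) ≤ w (η + h)) :
    ∃ M2, M2 ∉ S ∧ M2.IsSymm ∧ ∀ e, ptqf M2 e =
      ∑ i, ∑ k, e i * e k * A (vecField i η) (vecField k η)
      + ptLf (α η c) (β η c) (γ η c) (fun i => p (vecField i η)) e := by
  have hq0 : ptquad η c p A η = c := by simp [ptquad]
  obtain ⟨t1, t2⟩ := ptTest η c p A hA (g := fun s => s) (g1 := fun _ => 1) (g2 := 0)
    (fun s => hasDerivAt_id s) (hasDerivAt_const c 1)
  have hF := hsup η hη (fun y => ptquad η c p A y)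
    (ptquad_contDiff η c p A).contDiffOn (by simp only [hq0]; exact hv) (by
      have ht : Tendsto (fun y : Heis n => y - η) (𝓝 η) (𝓝 0) := by
        have : Continuous fun y : Heis n => y - η := by fun_prop
        simpa using this.tendsto η
      filter_upwards [ht.eventually hle] with y hy hyΩ
      simp only [add_sub_cancel] at hy
      exact hy hyΩ)
  refine ⟨_, hF, ptF_symm α β γ _ η, fun e => ?_⟩
  have hG : hGrad (fun y => ptquad η c p A y) η = (fun i => p (vecField i η)) := by
    funext i; rw [t1]; simp
  have hS : ptqf (hHessSym (fun y => ptquad η c p A y) η) e =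
      ∑ i, ∑ k, e i * e k * A (vecField i η) (vecField k η) := by
    simp [ptqf, t2]
  unfold Fop
  rw [ptqf_add, ptqf_L, hG, hS]
  simp only [hq0]

theorem ptAux {N ε t b b' P z Q : ℝ} (ht : 0 < t) (hN : 0 ≤ N)
    (hb : |b| ≤ N) (hbb : |b' - b| ≤ ε) (hP : 0 ≤ P) (hQ : 0 ≤ Q) (hz : z ^ 2 ≤ P * Q) :
    |b' * (P + 2 * z + Q) - b * P| ≤ (2 * ε + N * t) * P + (2 * ε + N * (1 / t + 1)) * Q := by
  have hε : 0 ≤ ε := (abs_nonneg _).trans hbb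
  have e1 : |2 * z| ≤ t * P + Q / t := by
    apply abs_le_of_sq_le_sq _ (by positivity)
    have : (t * P + Q / t) ^ 2 = (t * P - Q / t) ^ 2 + 4 * (P * Q) := by field_simp; ring
    nlinarith [sq_nonneg (t * P - Q / t)]
  have e2 : |2 * z| ≤ P + Q := by
    apply abs_le_of_sq_le_sq _ (by positivity)
    nlinarith [sq_nonneg (P - Q)]
  have e3 : |P + 2 * z + Q| ≤ 2 * P + 2 * Q := by
    rw [abs_le] at *
    constructor <;> linarith [e2.1, e2.2]
  have e4 : |2 * z + Q| ≤ t * P + Q / t + Q := by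
    rw [abs_le] at *
    constructor <;> linarith [e1.1, e1.2]
  have e5 : b' * (P + 2 * z + Q) - b * P = (b' - b) * (P + 2 * z + Q) + b * (2 * z + Q) := by ring
  rw [e5]
  refine (abs_add_le _ _).trans ?_
  rw [abs_mul, abs_mul]
  have e6 := mul_le_mul hbb e3 (abs_nonneg _) hε
  have e7 := mul_le_mul hb e4 (abs_nonneg _) hN
  calc _ ≤ _ := add_le_add e6 e7
    _ = _ := by ring

theorem ptAlg1 {N μ β₀ : ℝ} (hN : 1 ≤ N) (hμ : 0 < μ) (hβ : 0 < β₀) :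
    ∃ C > 0, ∃ ε > 0, ∀ a b c a' b' c' : ℝ, |a| ≤ N → |b| ≤ N → |c| ≤ N →
      |a' - a| ≤ ε → |b' - b| ≤ ε → |c' - c| ≤ ε → ∀ p r e : HIdx n → ℝ,
      -(μ * (ptdot p e ^ 2 + β₀ * (ptdot p p * ptdot e e))) - C * (ptdot r r * ptdot e e) ≤
        ptLf a' b' c' (p + r) e - ptLf a b c p e := by
  set t := μ * β₀ / (12 * N) with ht
  have htp : 0 < t := by positivity
  set ε := μ * β₀ / 24 with hε
  have hεp : 0 < ε := by positivity
  refine ⟨3 * (2 * ε + N * (1 / t + 1)), by positivity, ε, hεp, ?_⟩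
  intro a b c a' b' c' ha hb hc ha' hb' hc' p r e
  have hP := ptdot_nonneg p
  have hR := ptdot_nonneg r
  have hE := ptdot_nonneg e
  have hNt : N * t = μ * β₀ / 12 := by rw [ht]; field_simp
  have k1 : 0 ≤ 2 * ε + N * t := by positivity
  have k2 : 0 ≤ 2 * ε + N * (1 / t + 1) := by positivity
  have aux : ∀ {a a' : ℝ} {p r : HIdx n → ℝ}, |a| ≤ N → |a' - a| ≤ ε →
      |a' * (ptdot p e + ptdot r e) ^ 2 - a * ptdot p e ^ 2| ≤
      (2 * ε + N * t) * (ptdot p p * ptdot e e) +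
        (2 * ε + N * (1 / t + 1)) * (ptdot r r * ptdot e e) := by
    intro a a' p r h1 h2
    have := ptAux (z := ptdot p e * ptdot r e) htp (by linarith) h1 h2 (sq_nonneg (ptdot p e))
      (sq_nonneg (ptdot r e)) (by rw [mul_pow])
    have e1 : (ptdot p e + ptdot r e) ^ 2 = ptdot p e ^ 2 + 2 * (ptdot p e * ptdot r e)
      + ptdot r e ^ 2 := by ring
    rw [e1]
    refine this.trans ?_
    have := ptdot_cs p e
    have := ptdot_cs r e
    gcongr
  have i1 := aux (p := p) (r := r) ha ha'
  have i2 := aux (p := Jmat n *ᵥ p) (r := Jmat n *ᵥ r) hc hc'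
  rw [ptJ_norm, ptJ_norm] at i2
  have i3 := ptAux (z := ptdot p r) htp (by linarith) hb hb' hP hR (ptdot_cs p r)
  have hpr : ptdot (p + r) (p + r) = ptdot p p + 2 * ptdot p r + ptdot r r := by
    rw [ptdot_add, ptdot_comm p, ptdot_comm r, ptdot_add, ptdot_add, ptdot_comm r p]; ring
  have i4 := mul_le_mul_of_nonneg_right i3 hE
  rw [← abs_of_nonneg hE, ← abs_mul, abs_of_nonneg hE] at i4
  have j1 := (abs_le.1 i1).1
  have j2 := (abs_le.1 i2).2
  have j4 := (abs_le.1 i4).2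
  simp only [ptLf, mulVec_add, hpr]
  rw [ptdot_add, ptdot_add]
  have hs : 0 ≤ μ * ptdot p e ^ 2 := by positivity
  have hPE : 0 ≤ μ * β₀ * (ptdot p p * ptdot e e) := by positivity
  have hk : (2 * ε + N * t) = μ * β₀ / 6 := by rw [hNt, hε]; ring
  rw [hk] at j1 j2 j4
  nlinarith

theorem ptAlg2 {N μ : ℝ} (hN : 1 ≤ N) (hμ : 0 < μ) :
    ∃ C > 0, ∀ a : ℝ, |a| ≤ N → ∀ p r e : HIdx n → ℝ,
      -(μ * ptdot p e ^ 2) - C * (ptdot r r * ptdot e e) ≤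
        ptLf a 0 0 (p + r) e - ptLf a 0 0 p e := by
  set t := μ / N with ht
  have htp : 0 < t := by positivity
  refine ⟨N * (1 / t + 1), by positivity, ?_⟩
  intro a ha p r e
  have := ptAux (ε := 0) (b' := a) (z := ptdot p e * ptdot r e) htp (by linarith) ha (by simp)
    (sq_nonneg (ptdot p e)) (sq_nonneg (ptdot r e)) (by rw [mul_pow])
  have j1 := (abs_le.1 this).1
  have hNt : N * t = μ := by rw [ht]; field_simp
  have h2 : N * (1 / t + 1) * ptdot r e ^ 2 ≤ N * (1 / t + 1) * (ptdot r r * ptdot e e) := by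
    have := ptdot_cs r e
    gcongr
  simp only [ptLf, ptdot_add]
  rw [hNt] at j1
  nlinarith

theorem ptLdiff {K : Set (Heis n)} (hK : IsCompact K) {α β γ : Heis n → ℝ → ℝ}
    (hα : ContinuousOn (fun q : Heis n × ℝ => α q.1 q.2) (K ×ˢ Set.univ))
    (hβ : ContinuousOn (fun q : Heis n × ℝ => β q.1 q.2) (K ×ˢ Set.univ))
    (hγ : ContinuousOn (fun q : Heis n × ℝ => γ q.1 q.2) (K ×ˢ Set.univ))
    (hmono : ∀ ξ ∈ K, ∀ s s' : ℝ, s ≤ s' → ∀ p : HIdx n → ℝ,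
      matLE (Lquad α β γ ξ s p) (Lquad α β γ ξ s' p))
    {R N β₀ μ : ℝ} (hN : 1 ≤ N)
    (hbd : ∀ ξ ∈ K, ∀ s, |s| ≤ R → |α ξ s| ≤ N ∧ |β ξ s| ≤ N ∧ |γ ξ s| ≤ N)
    (hμ : 0 < μ)
    (hcase : 0 < β₀ ∨ (β₀ = 0 ∧ (∃ a : ℝ, ∀ ξ s, α ξ s = a) ∧ (∀ ξ s, β ξ s = 0) ∧
      ∀ ξ s, γ ξ s = 0)) :
    ∃ C > 0, ∃ ρ > 0, ∀ η ∈ K, ∀ ζ ∈ K, ∀ s s' : ℝ, |s| ≤ R → |s'| ≤ R → dist η ζ < ρ →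
      s ≤ s' + ρ → ∀ p r e : HIdx n → ℝ,
      -(μ * (ptdot p e ^ 2 + β₀ * (ptdot p p * ptdot e e))) - C * (ptdot r r * ptdot e e) ≤
        ptLf (α ζ s') (β ζ s') (γ ζ s') (p + r) e - ptLf (α η s) (β η s) (γ η s) p e := by
  rcases hcase with hb | ⟨hb, ⟨a, ha⟩, hb0, hc0⟩
  · obtain ⟨C, hC, ε, hε, h⟩ := ptAlg1 (n := n) hN hμ hb
    have hcomp : IsCompact (K ×ˢ Metric.closedBall (0 : ℝ) R) :=
      hK.prod (isCompact_closedBall _ _)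
    have huc : ∀ {f : Heis n → ℝ → ℝ},
        ContinuousOn (fun q : Heis n × ℝ => f q.1 q.2) (K ×ˢ Set.univ) →
        ∃ ρ > 0, ∀ η ∈ K, ∀ ζ ∈ K, ∀ s s' : ℝ, |s| ≤ R → |s'| ≤ R → dist η ζ < ρ →
          |s' - s| < ρ → |f ζ s' - f η s| ≤ ε := by
      intro f hf
      have hu := hcomp.uniformContinuousOn_of_continuous
        (hf.mono (Set.prod_mono subset_rfl (Set.subset_univ _)))
      obtain ⟨ρ, hρ, hh⟩ := Metric.uniformContinuousOn_iff.1 hu ε hε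
      refine ⟨ρ, hρ, fun η hη ζ hζ s s' hs hs' hd hss => ?_⟩
      have := hh (ζ, s') ⟨hζ, by simpa using hs'⟩ (η, s) ⟨hη, by simpa using hs⟩
        (by rw [Prod.dist_eq]; exact max_lt (by rw [dist_comm]; exact hd) hss)
      exact this.le
    obtain ⟨ρ1, h1, k1⟩ := huc hα
    obtain ⟨ρ2, h2, k2⟩ := huc hβ
    obtain ⟨ρ3, h3, k3⟩ := huc hγ
    set ρ := min ρ1 (min ρ2 ρ3) with hρ
    have hρp : 0 < ρ := by positivity
    have l1 : ρ ≤ ρ1 := min_le_left _ _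
    have l2 : ρ ≤ ρ2 := (min_le_right _ _).trans (min_le_left _ _)
    have l3 : ρ ≤ ρ3 := (min_le_right _ _).trans (min_le_right _ _)
    refine ⟨C, hC, ρ / 2, by positivity, ?_⟩
    intro η hη ζ hζ s s' hs hs' hd hss p r e
    have hm : |min s s'| ≤ R := by
      rcases min_choice s s' with h | h <;> rw [h] <;> assumption
    have hms : |min s s' - s| < ρ := by
      rw [abs_lt]
      constructor
      · rcases min_choice s s' with h | h <;> rw [h] <;> linarith
      · linarith [min_le_left s s']
    have hmon := ptqf_matLE (hmono ζ hζ (min s s') s' (min_le_right _ _) (p + r)) e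
    rw [ptqf_L, ptqf_L] at hmon
    obtain ⟨b1, b2, b3⟩ := hbd η hη s hs
    have := h _ _ _ _ _ _ b1 b2 b3
      (k1 η hη ζ hζ s _ hs hm (by linarith) (by linarith))
      (k2 η hη ζ hζ s _ hs hm (by linarith) (by linarith))
      (k3 η hη ζ hζ s _ hs hm (by linarith) (by linarith)) p r e
    linarith
  · obtain ⟨C, hC, h⟩ := ptAlg2 (n := n) hN hμ
    refine ⟨C, hC, 1, one_pos, ?_⟩
    intro η hη ζ hζ s s' hs hs' hd hss p r e
    have hb1 := (hbd η hη s hs).1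
    simp only [ha, hb0, hc0] at hb1 ⊢
    have := h a hb1 p r e
    rw [hb]
    linarith

end Visc

section GLem

theorem ptG {κ R l τ : ℝ} (hκ : 0 < κ) (hl : 0 < l) (hlk : l * κ ≤ 1 / 2)
    (hτ : τ = 1 ∨ τ = -1) :
    ∃ g g1 g2 G : ℝ → ℝ, ContDiff ℝ 2 g ∧ (∀ s, HasDerivAt g (g1 s) s) ∧
      (∀ s, HasDerivAt g1 (g2 s) s) ∧ StrictMono g ∧ StrictMono G ∧ Continuous G ∧
      (∀ s, g (G s) = s) ∧ (∀ s, G (g s) = s) ∧ (∀ s, g s ≤ s) ∧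
      ∃ μ0 > 0, ∀ c, |c| ≤ R → ∃ μ, μ0 ≤ μ ∧ μ ≤ 1 / 2 ∧ g1 c = 1 - τ * μ ∧
        μ * κ / 3 ≤ - (g2 c / g1 c) ∧ c - l ≤ g c := by
  have hτ2 : τ * τ = 1 := by rcases hτ with h | h <;> rw [h] <;> norm_num
  have hτa : |τ| = 1 := by rcases hτ with h | h <;> rw [h] <;> norm_num
  set E : ℝ → ℝ := fun s => Real.exp (κ * (τ * s - R)) with hE
  have hEp : ∀ s, 0 < E s := fun s => Real.exp_pos _
  have hEd : ∀ s, HasDerivAt E (E s * (κ * τ)) s := by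
    intro s
    have h1 : HasDerivAt (fun s : ℝ => κ * (τ * s - R)) (κ * τ) s := by
      have := (((hasDerivAt_id s).const_mul τ).sub_const R).const_mul κ
      simpa using this
    exact h1.exp
  set sg : ℝ → ℝ := fun s => E s / (1 + E s) with hsg
  have hsg0 : ∀ s, 0 < sg s := fun s => by
    have := hEp s
    simp only [hsg]; positivity
  have hsg1 : ∀ s, sg s < 1 := fun s => by
    have := hEp s
    simp only [hsg]
    rw [div_lt_one (by positivity)]; linarith
  set g : ℝ → ℝ := fun s => s - l * Real.log (1 + E s) with hg
  set g1 : ℝ → ℝ := fun s => 1 - l * κ * τ * sg s with hg1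
  set g2 : ℝ → ℝ := fun s => - (l * κ ^ 2 * (sg s * (1 - sg s))) with hg2
  have hgc : ContDiff ℝ 2 g := by
    have h1 : ContDiff ℝ 2 (fun s => 1 + E s) := by
      simp only [hE]; fun_prop
    have := h1.log (fun s => by have := hEp s; positivity)
    simp only [hg]
    exact contDiff_id.sub (contDiff_const.mul this)
  have hgd : ∀ s, HasDerivAt g (g1 s) s := by
    intro s
    have h1 : HasDerivAt (fun s => 1 + E s) (E s * (κ * τ)) s := (hEd s).const_add 1
    have h2 := h1.log (by have := hEp s; positivity)
    have h3 := (hasDerivAt_id s).sub (h2.const_mul l)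
    refine h3.congr_deriv ?_
    simp only [hg1, hsg]
    ring
  have hg1d : ∀ s, HasDerivAt g1 (g2 s) s := by
    intro s
    have h0 := hEp s
    have h1 : HasDerivAt (fun s => 1 + E s) (E s * (κ * τ)) s := (hEd s).const_add 1
    have h2 := (hEd s).div h1 (by positivity)
    have h3 := (h2.const_mul (l * κ * τ)).const_sub 1
    refine h3.congr_deriv ?_
    simp only [hg2, hsg]
    field_simp
    linear_combination (-1 : ℝ) * hτ2
  have hg1p : ∀ s, 1 / 2 ≤ g1 s := by
    intro s
    have h1 := hsg0 s
    have h2 := hsg1 s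
    have h4 : l * κ * sg s ≤ 1 / 2 := by
      have : 0 ≤ l * κ := by positivity
      nlinarith
    have h5 : 0 < l * κ * sg s := by positivity
    simp only [hg1]
    rcases hτ with h | h <;> rw [h] <;> nlinarith
  have hmono : StrictMono g :=
    strictMono_of_deriv_pos fun s => by
      rw [(hgd s).deriv]; linarith [hg1p s]
  have hcont : Continuous g := hgc.continuous
  have hgle : ∀ s, g s ≤ s := by
    intro s
    have : 0 ≤ Real.log (1 + E s) := Real.log_nonneg (by linarith [hEp s])
    simp only [hg]
    nlinarith
  -- growth
  have hgrow : ∀ s t, s ≤ t → (t - s) / 2 ≤ g t - g s := by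
    intro s t hst
    have hm : Monotone (fun s => g s - s / 2) := by
      apply monotone_of_deriv_nonneg
      · intro s
        exact ((hgd s).sub ((hasDerivAt_id s).div_const 2)).differentiableAt
      · intro s
        have := ((hgd s).sub ((hasDerivAt_id s).div_const 2))
        have h2 : deriv (fun s => g s - s / 2) s = g1 s - 1 / 2 := this.deriv
        rw [h2]; linarith [hg1p s]
    have := hm hst
    simp only at this
    linarith
  have htop : Tendsto g atTop atTop := by
    apply tendsto_atTop_mono' atTop (f₁ := fun s => g 0 + s / 2)
    · filter_upwards [eventually_ge_atTop 0] with s hs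
      have := hgrow 0 s hs
      linarith
    · exact tendsto_atTop_add_const_left _ _ (tendsto_id.atTop_div_const (by norm_num))
  have hbot : Tendsto g atBot atBot := by
    exact tendsto_atBot_mono hgle tendsto_id
  have hsurj : Function.Surjective g := hcont.surjective htop hbot
  let e : ℝ ≃o ℝ := hmono.orderIsoOfSurjective g hsurj
  refine ⟨g, g1, g2, e.symm, hgc, hgd, hg1d, hmono, e.symm.strictMono, e.symm.continuous,
    fun s => e.apply_symm_apply s, fun s => e.symm_apply_apply s, hgle,
    l * κ * (Real.exp (κ * (-R - R)) / 2), by positivity, ?_⟩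
  intro c hc
  have h1 := hsg0 c
  have h2 := hsg1 c
  have h0 := hEp c
  have hlkp : 0 < l * κ := by positivity
  have hτc : |τ * c| ≤ R := by rw [abs_mul, hτa, one_mul]; exact hc
  obtain ⟨hc1, hc2⟩ := abs_le.1 hτc
  have hE1 : E c ≤ 1 := by
    simp only [hE]
    rw [Real.exp_le_one_iff]
    nlinarith
  have hE2 : Real.exp (κ * (-R - R)) ≤ E c := by
    simp only [hE]
    apply Real.exp_le_exp.2
    apply mul_le_mul_of_nonneg_left _ hκ.le
    linarith
  have hs12 : sg c ≤ 1 / 2 := by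
    simp only [hsg]
    rw [div_le_iff₀ (by positivity)]; linarith
  refine ⟨l * κ * sg c, ?_, ?_, ?_, ?_, ?_⟩
  · apply mul_le_mul_of_nonneg_left _ hlkp.le
    simp only [hsg]
    rw [div_le_div_iff₀ (by norm_num) (by positivity)]
    nlinarith
  · nlinarith
  · simp only [hg1]; ring
  · have hgp := hg1p c
    have hgu : g1 c ≤ 3 / 2 := by
      simp only [hg1]
      rcases hτ with h | h <;> rw [h] <;> nlinarith
    rw [← neg_div, le_div_iff₀ (by linarith)]
    simp only [hg2]
    have hx : 0 ≤ l * κ * sg c * κ := by positivity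
    have : l * κ * sg c * κ / 3 * g1 c ≤ l * κ * sg c * κ / 2 := by nlinarith
    nlinarith
  · have : Real.log (1 + E c) ≤ 1 := by
      have := Real.log_le_sub_one_of_pos (x := 1 + E c) (by positivity)
      linarith
    simp only [hg]
    nlinarith

end GLem

section Prep

variable {n : ℕ}

theorem ptZb : ∃ Z : Heis n →L[ℝ] Heis n →L[ℝ] ℝ, (∀ h k, Z h k = Z k h) ∧
    (∀ h, Z h h = zsq h) ∧
    ∀ i k (η : Heis n), Z (vecField i η) (vecField k η) = if i = k then 1 else 0 := by
  let a : Fin n → Heis n →L[ℝ] ℝ := fun i =>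
    (ContinuousLinearMap.proj i).comp (ContinuousLinearMap.fst ℝ _ _)
  let b : Fin n → Heis n →L[ℝ] ℝ := fun i =>
    (ContinuousLinearMap.proj i).comp
      ((ContinuousLinearMap.fst ℝ _ _).comp (ContinuousLinearMap.snd ℝ _ _))
  have ha : ∀ i h, a i h = h.1 i := fun i h => rfl
  have hb : ∀ i h, b i h = h.2.1 i := fun i h => rfl
  let Z : Heis n →L[ℝ] Heis n →L[ℝ] ℝ :=
    ∑ i, ((a i).smulRight (a i) + (b i).smulRight (b i))
  have hZ : ∀ h k, Z h k = ∑ i, (h.1 i * k.1 i + h.2.1 i * k.2.1 i) := by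
    intro h k
    simp [Z, _root_.sum_apply, ha, hb]
  refine ⟨Z, fun h k => ?_, fun h => ?_, fun i k η => ?_⟩
  · rw [hZ, hZ]
    exact Finset.sum_congr rfl fun i _ => by ring
  · rw [hZ, zsq]
    exact Finset.sum_congr rfl fun i _ => by ring
  · rw [hZ]
    rcases i with i | i <;> rcases k with k | k <;>
      simp [vecField, Pi.single_apply, eq_comm]

theorem ptsV {η : Heis n} {s : Heis n →L[ℝ] ℝ}
    (hs : ∀ h, s h = ∑ i, (2 * η.1 i * h.1 i + 2 * η.2.1 i * h.2.1 i)) (i : HIdx n) :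
    |s (vecField i η)| ≤ 2 * ‖η‖ := by
  rw [hs]
  rcases i with i | i
  · simp [vecField, Pi.single_apply, abs_mul]
    exact ptCoord1 η i
  · simp [vecField, Pi.single_apply, abs_mul]
    exact ptCoord2 η i

theorem ptComp {K C : Set (Heis n)} (hC : IsCompact C) (hCK : C ⊆ K) {v w : Heis n → EReal}
    (hv : UpperSemicontinuousOn v K) (hw : LowerSemicontinuousOn w K) {d : ℝ}
    (h : ∀ ξ ∈ C, ∃ m δ : ℝ, d < δ ∧ v ξ < (m : EReal) ∧ ((m + δ : ℝ) : EReal) < w ξ) :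
    ∃ ρ > 0, ∃ δ > d, ∀ ξ ∈ C, ∀ η ∈ K, ∀ ζ ∈ K, dist η ξ < ρ → dist ζ ξ < ρ →
      ∀ s s' : ℝ, v η = (s : EReal) → w ζ = (s' : EReal) → s + δ < s' := by
  refine hC.induction_on (p := fun C => ∃ ρ > 0, ∃ δ > d, ∀ ξ ∈ C, ∀ η ∈ K, ∀ ζ ∈ K,
      dist η ξ < ρ → dist ζ ξ < ρ →
      ∀ s s' : ℝ, v η = (s : EReal) → w ζ = (s' : EReal) → s + δ < s') ?_ ?_ ?_ ?_
  · exact ⟨1, one_pos, d + 1, by linarith, by simp⟩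
  · rintro s t hst ⟨ρ, hρ, δ, hδ, hh⟩
    exact ⟨ρ, hρ, δ, hδ, fun ξ hξ => hh ξ (hst hξ)⟩
  · rintro s t ⟨ρ, hρ, δ, hδ, hh⟩ ⟨ρ', hρ', δ', hδ', hh'⟩
    refine ⟨min ρ ρ', lt_min hρ hρ', min δ δ', lt_min hδ hδ', ?_⟩
    intro ξ hξ η hη ζ hζ h1 h2 s s' hs hs'
    rcases hξ with hξ | hξ
    · have := hh ξ hξ η hη ζ hζ (h1.trans_le (min_le_left _ _)) (h2.trans_le (min_le_left _ _))
        s s' hs hs'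
      linarith [min_le_left δ δ']
    · have := hh' ξ hξ η hη ζ hζ (h1.trans_le (min_le_right _ _)) (h2.trans_le (min_le_right _ _))
        s s' hs hs'
      linarith [min_le_right δ δ']
  · intro ξ hξ
    obtain ⟨m, δ, hδ, h1, h2⟩ := h ξ hξ
    have e1 := hv ξ (hCK hξ) _ h1
    have e2 := hw ξ (hCK hξ) _ h2
    obtain ⟨ρ, hρ, hb⟩ := Metric.mem_nhdsWithin_iff.1 (e1.and e2)
    refine ⟨C ∩ Metric.ball ξ (ρ / 2), inter_mem_nhdsWithin _ (Metric.ball_mem_nhds _ (by positivity)),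
      ρ / 2, by positivity, δ, hδ, ?_⟩
    rintro x ⟨hx, hxb⟩ η hη ζ hζ d1 d2 s s' hs hs'
    rw [Metric.mem_ball] at hxb
    have f1 := (hb ⟨Metric.mem_ball.2 (by linarith [dist_triangle η x ξ]), hη⟩).1
    have f2 := (hb ⟨Metric.mem_ball.2 (by linarith [dist_triangle ζ x ξ]), hζ⟩).2
    simp only [hs, hs', EReal.coe_lt_coe_iff] at f1 f2
    linarith

theorem ptLip {X : Type*} [PseudoMetricSpace X] {s : Set X} {f : X → ℝ}
    (h : LocallyLipschitzOnSet s f) : ContinuousOn f s := by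
  intro x hx
  obtain ⟨K, t, ht, hl⟩ := h x hx
  have hxt : x ∈ t := mem_of_mem_nhdsWithin hx ht
  exact (hl.continuousOn x hxt).mono_of_mem_nhdsWithin ht

theorem ptStruct {K : Set (Heis n)} {α β γ : Heis n → ℝ → ℝ} (hstruct :
      (∃ β₀ : ℝ, 0 < β₀ ∧ ∀ ξ ∈ K, ∀ s : ℝ, β₀ < β ξ s ∧ 0 ≤ γ ξ s) ∨
      (∃ β₀ : ℝ, 0 < β₀ ∧ ∀ ξ ∈ K, ∀ s : ℝ, β ξ s < -β₀ ∧ γ ξ s ≤ 0) ∨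
      ((∃ a : ℝ, ∀ ξ s, α ξ s = a) ∧ (∃ b : ℝ, ∀ ξ s, β ξ s = b) ∧
        (∀ ξ s, γ ξ s = 0))) :
    ∃ τ β₀ : ℝ, (τ = 1 ∨ τ = -1) ∧ 0 ≤ β₀ ∧
      (∀ ξ ∈ K, ∀ s, β₀ ≤ - τ * β ξ s ∧ 0 ≤ - τ * γ ξ s) ∧
      (0 < β₀ ∨ (β₀ = 0 ∧ (∃ a : ℝ, ∀ ξ s, α ξ s = a) ∧ (∀ ξ s, β ξ s = 0) ∧
      ∀ ξ s, γ ξ s = 0)) := by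
  rcases hstruct with ⟨b, hb, h⟩ | ⟨b, hb, h⟩ | ⟨ha, ⟨b, hb⟩, hc⟩
  · refine ⟨-1, b, Or.inr rfl, hb.le, fun ξ hξ s => ?_, Or.inl hb⟩
    have := h ξ hξ s
    constructor <;> linarith
  · refine ⟨1, b, Or.inl rfl, hb.le, fun ξ hξ s => ?_, Or.inl hb⟩
    have := h ξ hξ s
    constructor <;> linarith
  · rcases lt_trichotomy b 0 with h | h | h
    · refine ⟨1, -b, Or.inl rfl, by linarith, fun ξ hξ s => ?_, Or.inl (by linarith)⟩
      rw [hb, hc]; constructor <;> linarith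
    · refine ⟨1, 0, Or.inl rfl, le_rfl, fun ξ hξ s => ?_, Or.inr ⟨rfl, ha, fun ξ s => ?_, hc⟩⟩
      · rw [hb, hc]; constructor <;> linarith
      · rw [hb, h]
    · refine ⟨-1, b, Or.inr rfl, by linarith, fun ξ hξ s => ?_, Or.inl h⟩
      rw [hb, hc]; constructor <;> linarith

theorem ptBound {K : Set (Heis n)} (hK : IsCompact K) {α : Heis n → ℝ → ℝ}
    (hα : ContinuousOn (fun q : Heis n × ℝ => α q.1 q.2) (K ×ˢ Set.univ)) (R : ℝ) :
    ∃ N, ∀ ξ ∈ K, ∀ s, |s| ≤ R → |α ξ s| ≤ N := by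
  have hcomp : IsCompact (K ×ˢ Metric.closedBall (0 : ℝ) R) :=
      hK.prod (isCompact_closedBall _ _)
  obtain ⟨N, hN⟩ := hcomp.exists_bound_of_continuousOn
    (hα.mono (Set.prod_mono subset_rfl (Set.subset_univ _)))
  exact ⟨N, fun ξ hξ s hs => hN (ξ, s) ⟨hξ, by simpa using hs⟩⟩

/-- The final algebraic inequality. -/
theorem ptFinalAlg {N μ μ0 β₀ τ C θ ε a b c κ X Y q : ℝ} {P r e : HIdx n → ℝ}
    (hμ0 : 0 < μ0) (hμ : μ0 ≤ μ) (hτ : τ = 1 ∨ τ = -1) (ha : |a| ≤ N) (hb : β₀ ≤ -τ * b)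
    (hc : 0 ≤ -τ * c) (hβ₀ : 0 ≤ β₀) (hκ : κ = 3 * (N + 1)) (hq : μ * κ / 3 ≤ -q) (hεθ : ε ≤ θ)
    (hr : C * ptdot r r ≤ θ / 2)
    (hX : X ≤ ε * ptdot e e)
    (hY : -(μ0 * (ptdot P e ^ 2 + β₀ * (ptdot P P * ptdot e e))) - C * (ptdot r r * ptdot e e)
      ≤ Y - ptLf a b c P e) :
    θ / 2 * ptdot e e ≤ (Y - X + 2 * θ * ptdot e e)
      - (q * ptdot P e ^ 2 + (1 - τ * μ) * ptLf a b c P e) := by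
  have hE := ptdot_nonneg e
  have hP := ptdot_nonneg P
  have hJ : 0 ≤ ptdot (Jmat n *ᵥ P) e ^ 2 := sq_nonneg _
  have hA : 0 ≤ ptdot P e ^ 2 := sq_nonneg _
  have hPE : 0 ≤ ptdot P P * ptdot e e := mul_nonneg hP hE
  have h1 : ε * ptdot e e ≤ θ * ptdot e e := mul_le_mul_of_nonneg_right hεθ hE
  have h2 : C * (ptdot r r * ptdot e e) ≤ θ / 2 * ptdot e e := by
    rw [← mul_assoc]; exact mul_le_mul_of_nonneg_right hr hE
  have hμp : 0 < μ := by linarith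
  have h3 : μ * (N + 1) * ptdot P e ^ 2 ≤ -q * ptdot P e ^ 2 := by
    apply mul_le_mul_of_nonneg_right _ hA
    rw [hκ] at hq; linarith
  have h4 : -(N * ptdot P e ^ 2) + β₀ * (ptdot P P * ptdot e e) ≤ τ * ptLf a b c P e := by
    have k1 : -(N * ptdot P e ^ 2) ≤ τ * a * ptdot P e ^ 2 := by
      have : -N ≤ τ * a := by
        obtain ⟨l1, l2⟩ := abs_le.1 ha
        rcases hτ with h | h <;> rw [h] <;> linarith
      nlinarith
    have k2 := mul_le_mul_of_nonneg_right hb hPE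
    have k3 := mul_nonneg hc hJ
    simp only [ptLf]
    nlinarith
  have h5 := mul_le_mul_of_nonneg_left h4 hμp.le
  have h6 : μ0 * (ptdot P e ^ 2 + β₀ * (ptdot P P * ptdot e e)) ≤
      μ * (ptdot P e ^ 2 + β₀ * (ptdot P P * ptdot e e)) :=
    mul_le_mul_of_nonneg_right hμ (by positivity)
  nlinarith

end Prep

section Core

variable {n : ℕ}

theorem ptSmall (a : ℝ) {b : ℝ} (hb : 0 < b) :
    ∃ t0 > 0, ∀ t, 0 ≤ t → t ≤ t0 → t * a ≤ b := by
  refine ⟨b / (|a| + 1), by positivity, fun t ht h => ?_⟩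
  rw [le_div_iff₀ (by positivity)] at h
  nlinarith [le_abs_self a]

theorem ptFactA {a b : EReal} (ha : a ≠ ⊤) (hb : b ≠ ⊥) (hab : a ≤ b) {d : ℝ} (hd : 0 < d) :
    ∃ m δ : ℝ, -d < δ ∧ a < (m : EReal) ∧ ((m + δ : ℝ) : EReal) < b := by
  have hx : ∃ x : ℝ, a ≤ (x : EReal) ∧ (x : EReal) ≤ b := by
    induction a with
    | top => exact absurd rfl ha
    | coe x => exact ⟨x, le_rfl, hab⟩
    | bot =>
      induction b with
      | top => exact ⟨0, bot_le, le_top⟩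
      | coe x => exact ⟨x, bot_le, le_rfl⟩
      | bot => exact absurd rfl hb
  obtain ⟨x, h1, h2⟩ := hx
  refine ⟨x + d / 4, -d / 2, by linarith, h1.trans_lt ?_, lt_of_lt_of_le ?_ h2⟩
  · rw [EReal.coe_lt_coe_iff]; linarith
  · rw [EReal.coe_lt_coe_iff]; linarith

theorem ptFactB {a b : EReal} (hab : a < b) :
    ∃ m δ : ℝ, 0 < δ ∧ a < (m : EReal) ∧ ((m + δ : ℝ) : EReal) < b := by
  obtain ⟨x, h1, h2⟩ := EReal.lt_iff_exists_real_btwn.1 hab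
  obtain ⟨y, h3, h4⟩ := EReal.lt_iff_exists_real_btwn.1 h2
  rw [EReal.coe_lt_coe_iff] at h3
  exact ⟨x, y - x, by linarith, h1, by simpa using h4⟩

/-- The jets produced by doubling of variables contradict the equations. -/
theorem ptCore {Ω : Set (Heis n)} {α β γ : Heis n → ℝ → ℝ} {S : Set (HMat n)}
    (hSsymm : ∀ A ∈ S, A.IsSymm)
    (hSpos : ∀ A ∈ S, ∀ B : HMat n, B.PosDef → A + B ∈ S)
    (hScone : ∀ A ∈ S, ∀ c : ℝ, 0 < c → c • A ∈ S)
    {w v : Heis n → EReal}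
    (hwsuper : IsSupersolution Ω (Lquad α β γ) S w)
    (hvsub : IsSubsolution Ω (Lquad α β γ) S v)
    {η ζ : Heis n} (hη : η ∈ Ω) (hζ : ζ ∈ Ω)
    {g g1 : ℝ → ℝ} {g2 c s' : ℝ} (hgc : ContDiff ℝ 2 g)
    (hg : ∀ s, HasDerivAt g (g1 s) s) (hg1 : HasDerivAt g1 g2 c) (hpos : 0 < g1 c)
    (hv : v η = ((g c : ℝ) : EReal)) (hw : w ζ = ((s' : ℝ) : EReal))
    {p q : Heis n →L[ℝ] ℝ} {A B : Heis n →L[ℝ] Heis n →L[ℝ] ℝ}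
    (hA : ∀ h k, A h k = A k h) (hB : ∀ h k, B h k = B k h)
    {θ ε : ℝ} (hθ : 0 < θ)
    (hle1 : ∀ᶠ h in 𝓝 (0 : Heis n), η + h ∈ Ω →
      v (η + h) ≤ ((g (c + θ * zsq η + p h + (1 / 2) * A h h - θ * zsq (η + h)) : ℝ) : EReal))
    (hle2 : ∀ᶠ h in 𝓝 (0 : Heis n), ζ + h ∈ Ω →
      (((s' - q h - (1 / 2) * B h h : ℝ)) : EReal) ≤ w (ζ + h))
    (hpq : ∀ i, |p (vecField i η) + q (vecField i ζ)| ≤ ε)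
    (hAB : ∀ e : HIdx n → ℝ, ∑ i, ∑ k, e i * e k *
      (A (vecField i η) (vecField k η) + B (vecField i ζ) (vecField k ζ)) ≤ ε * ∑ i, e i ^ 2)
    {N μ μ0 β₀ τ C κ RK : ℝ} (hμ0 : 0 < μ0) (hμ : μ0 ≤ μ) (hτ : τ = 1 ∨ τ = -1)
    (ha : |α η (g c)| ≤ N)
    (hb : β₀ ≤ -τ * β η (g c)) (hcc : 0 ≤ -τ * γ η (g c)) (hβ₀ : 0 ≤ β₀)
    (hκ : κ = 3 * (N + 1)) (hq : μ * κ / 3 ≤ -(g2 / g1 c)) (hg1μ : g1 c = 1 - τ * μ)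
    (hεθ : ε ≤ θ) (hC : 0 < C) (hRK : ‖η‖ ≤ RK)
    (hCθ : θ * (C * (2 * n * (2 * RK + 1) ^ 2)) ≤ 1 / 2)
    (hL : ∀ p r e : HIdx n → ℝ,
      -(μ0 * (ptdot p e ^ 2 + β₀ * (ptdot p p * ptdot e e))) - C * (ptdot r r * ptdot e e) ≤
        ptLf (α ζ s') (β ζ s') (γ ζ s') (p + r) e
          - ptLf (α η (g c)) (β η (g c)) (γ η (g c)) p e) : False := by
  obtain ⟨Z, hZs, hZz, hZV⟩ := ptZb (n := n)
  obtain ⟨sL, hs1, hs2⟩ := zsq_expand η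
  set p0 : Heis n →L[ℝ] ℝ := p - θ • sL with hp0
  set A0 : Heis n →L[ℝ] Heis n →L[ℝ] ℝ := A - (2 * θ) • Z with hA0
  have hA0s : ∀ h k, A0 h k = A0 k h := by
    intro h k
    simp only [hA0, _root_.sub_apply, _root_.smul_apply, hA h k, hZs h k]
  obtain ⟨M1, hM1, hM1q⟩ := ptSub hvsub hScone hη hA0s hgc hg hg1 hpos hv (p := p0) (by
    filter_upwards [hle1] with h hh hΩ
    have := hh hΩ
    have e1 : c + θ * zsq η + p h + (1 / 2) * A h h - θ * zsq (η + h) =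
        c + p0 h + 1 / 2 * A0 h h := by
      simp only [hp0, hA0, _root_.sub_apply, _root_.smul_apply, smul_eq_mul, hZz, hs1]
      ring
    rwa [e1] at this)
  obtain ⟨M2, hM2, hM2s, hM2q⟩ := ptSuper hwsuper hζ (A := -B) (p := -q) (c := s')
    (by intro h k; simp [hB h k]) hw (by
      filter_upwards [hle2] with h hh hΩ
      have := hh hΩ
      have e1 : s' - q h - (1 / 2) * B h h = s' + (-q) h + 1 / 2 * (-B) h h := by
        simp only [_root_.neg_apply]; ring
      rwa [e1] at this)
  apply hM2
  refine ptMatLemma hSsymm hSpos hM1 hM2s (c := θ / 2) (by positivity) fun e => ?_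
  set P : HIdx n → ℝ := fun i => p0 (vecField i η) with hP
  set r : HIdx n → ℝ := fun i => (-q) (vecField i ζ) - P i with hr
  have hPr : (fun i => (-q) (vecField i ζ)) = P + r := by
    funext i; simp [hr]
  have hri : ∀ i, |r i| ≤ (2 * RK + 1) * θ := by
    intro i
    have h1 := hpq i
    have h2 := ptsV hs2 i
    have e1 : r i = -(p (vecField i η) + q (vecField i ζ)) + θ * sL (vecField i η) := by
      simp only [hr, hP, hp0, _root_.neg_apply, _root_.sub_apply, _root_.smul_apply, smul_eq_mul]
      ring
    rw [e1]
    refine (abs_add_le _ _).trans ?_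
    rw [abs_neg, abs_mul, abs_of_pos hθ]
    nlinarith
  have hrr : ptdot r r ≤ 2 * n * ((2 * RK + 1) * θ) ^ 2 := by
    have h1 : ptdot r r ≤ ∑ _i : HIdx n, ((2 * RK + 1) * θ) ^ 2 := by
      refine Finset.sum_le_sum fun i _ => ?_
      rw [← sq]
      exact sq_le_sq' (by linarith [(abs_le.1 (hri i)).1]) (abs_le.1 (hri i)).2
    refine h1.trans (le_of_eq ?_)
    rw [Finset.sum_const, nsmul_eq_mul, Finset.card_univ, Fintype.card_sum, Fintype.card_fin]
    push_cast
    ring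
  have hCr : C * ptdot r r ≤ θ / 2 := by
    have h1 := mul_le_mul_of_nonneg_left hrr hC.le
    have h2 := mul_le_mul_of_nonneg_left hCθ hθ.le
    nlinarith
  have hE : ∑ i, e i ^ 2 = ptdot e e :=
    Finset.sum_congr rfl fun i _ => by ring
  have hY := hL P r e
  rw [← hPr] at hY
  have hX := hAB e
  rw [hE] at hX
  have key := ptFinalAlg hμ0 hμ hτ ha hb hcc hβ₀ hκ hq hεθ hCr hX hY
  rw [← hg1μ] at key
  rw [hM2q, hM1q]
  have hsA : ∑ i, ∑ k, e i * e k * A0 (vecField i η) (vecField k η) =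
      ∑ i, ∑ k, e i * e k * A (vecField i η) (vecField k η) - 2 * θ * ptdot e e := by
    have : ptdot e e = ∑ i, ∑ k, e i * e k * (if i = k then 1 else 0) := by
      simp [ptdot]
    rw [this, Finset.mul_sum, ← Finset.sum_sub_distrib]
    refine Finset.sum_congr rfl fun i _ => ?_
    rw [Finset.mul_sum, ← Finset.sum_sub_distrib]
    refine Finset.sum_congr rfl fun k _ => ?_
    simp only [hA0, _root_.sub_apply, _root_.smul_apply, smul_eq_mul, hZV]
    ring
  have hsB : ∑ i, ∑ k, e i * e k * (-B) (vecField i ζ) (vecField k ζ) =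
      ∑ i, ∑ k, e i * e k * A (vecField i η) (vecField k η) -
      ∑ i, ∑ k, e i * e k *
      (A (vecField i η) (vecField k η) + B (vecField i ζ) (vecField k ζ)) := by
    simp only [← Finset.sum_sub_distrib]
    refine Finset.sum_congr rfl fun i _ => Finset.sum_congr rfl fun k _ => ?_
    simp only [_root_.neg_apply]
    ring
  rw [hsA, hsB]
  linarith

end Core

/-- Principle of propagation of touching points for the quadratic operators
`F[ψ] = ∇²_{H,s}ψ + α(·,ψ) ∇_Hψ⊗∇_Hψ - γ(·,ψ) J∇_Hψ⊗J∇_Hψ - β(·,ψ)|∇_Hψ|² I₂ₙ`. -/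
theorem propagation_of_touching_points_quadratic
    {n : ℕ} (hn : 1 ≤ n)
    (Ω : Set (Heis n)) (hΩopen : IsOpen Ω) (hΩbdd : Bornology.IsBounded Ω)
    (S : Set (HMat n)) (hSne : S.Nonempty) (hSsymm : ∀ A ∈ S, A.IsSymm)
    (hSopen : RelOpen S)
    (hSpos : ∀ A ∈ S, ∀ B : HMat n, B.PosDef → A + B ∈ S)
    (hScone : ∀ A ∈ S, ∀ c : ℝ, 0 < c → c • A ∈ S)
    (α β γ : Heis n → ℝ → ℝ)
    (hα : LocallyLipschitzOnSet (closure Ω ×ˢ (Set.univ : Set ℝ))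
      (fun q : Heis n × ℝ => α q.1 q.2))
    (hβ : LocallyLipschitzOnSet (closure Ω ×ˢ (Set.univ : Set ℝ))
      (fun q : Heis n × ℝ => β q.1 q.2))
    (hγ : LocallyLipschitzOnSet (closure Ω ×ˢ (Set.univ : Set ℝ))
      (fun q : Heis n × ℝ => γ q.1 q.2))
    (hmono : ∀ ξ ∈ closure Ω, ∀ s s' : ℝ, s ≤ s' → ∀ p : HIdx n → ℝ,
      matLE (Lquad α β γ ξ s p) (Lquad α β γ ξ s' p))
    (hstruct :
      (∃ β₀ : ℝ, 0 < β₀ ∧ ∀ ξ ∈ closure Ω, ∀ s : ℝ, β₀ < β ξ s ∧ 0 ≤ γ ξ s) ∨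
      (∃ β₀ : ℝ, 0 < β₀ ∧ ∀ ξ ∈ closure Ω, ∀ s : ℝ, β ξ s < -β₀ ∧ γ ξ s ≤ 0) ∨
      ((∃ a : ℝ, ∀ ξ s, α ξ s = a) ∧ (∃ b : ℝ, ∀ ξ s, β ξ s = b) ∧
        (∀ ξ s, γ ξ s = 0)))
    (w v : Heis n → EReal)
    (hw : LSCFun (closure Ω) w) (hv : USCFun (closure Ω) v)
    (hwsuper : IsSupersolution Ω (Lquad α β γ) S w)
    (hvsub : IsSubsolution Ω (Lquad α β γ) S v)
    (hge : ∀ ξ ∈ Ω, v ξ ≤ w ξ)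
    (hbdry : ∀ ξ ∈ frontier Ω, v ξ < w ξ) :
    ∀ ξ ∈ Ω, v ξ < w ξ := by
  intro ξ0 hξ0
  by_contra hcon
  have hnot : w ξ0 ≤ v ξ0 := not_lt.1 hcon
  have hvw0 : v ξ0 = w ξ0 := le_antisymm (hge ξ0 hξ0) hnot
  set K := closure Ω with hKdef
  have hΩK : Ω ⊆ K := subset_closure
  have hKc : IsCompact K := hΩbdd.isCompact_closure
  have hKΩ : ∀ ξ ∈ K, ξ ∉ Ω → ξ ∈ frontier Ω := by
    intro ξ hξ hn
    rw [hΩopen.frontier_eq]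
    exact ⟨hξ, hn⟩
  obtain ⟨hvu, hvt, -⟩ := hv
  obtain ⟨hwl, hwb, -⟩ := hw
  have hvw : ∀ ξ ∈ K, v ξ ≤ w ξ := by
    intro ξ hξ
    by_cases h : ξ ∈ Ω
    · exact hge ξ h
    · exact (hbdry ξ (hKΩ ξ hξ h)).le
  obtain ⟨r0, hr0⟩ : ∃ r0 : ℝ, v ξ0 = (r0 : EReal) := by
    refine ⟨(v ξ0).toReal, (EReal.coe_toReal (hvt ξ0 (hΩK hξ0)) ?_).symm⟩
    rw [hvw0]; exact hwb ξ0 (hΩK hξ0)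
  have hr0w : w ξ0 = (r0 : EReal) := by rw [← hvw0, hr0]
  obtain ⟨C1, hC1p, hC1⟩ : ∃ C1 : ℝ, 0 ≤ C1 ∧ ∀ ξ ∈ K, v ξ ≤ (C1 : EReal) := by
    obtain ⟨m, hm, hM⟩ := hvu.exists_isMaxOn ⟨ξ0, hΩK hξ0⟩ hKc
    refine ⟨max (v m).toReal 0, le_max_right _ _, fun ξ hξ => ?_⟩
    exact ((hM hξ).trans (EReal.le_coe_toReal (hvt m hm))).trans
      (EReal.coe_le_coe_iff.2 (le_max_left _ _))
  obtain ⟨C2, hC2p, hC2⟩ : ∃ C2 : ℝ, 0 ≤ C2 ∧ ∀ ξ ∈ K, ((-C2 : ℝ) : EReal) ≤ w ξ := by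
    obtain ⟨m, hm, hM⟩ := hwl.exists_isMinOn ⟨ξ0, hΩK hξ0⟩ hKc
    refine ⟨max (-(w m).toReal) 0, le_max_right _ _, fun ξ hξ => ?_⟩
    refine le_trans (EReal.coe_le_coe_iff.2 ?_) ((EReal.coe_toReal_le (hwb m hm)).trans (hM hξ))
    linarith [le_max_left (-(w m).toReal) 0]
  obtain ⟨RK, hRK⟩ := hKc.isBounded.exists_norm_le
  have hRK0 : 0 ≤ RK := (norm_nonneg _).trans (hRK ξ0 (hΩK hξ0))
  set R : ℝ := C1 + C2 + 3 with hR
  have hαc := ptLip hα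
  have hβc := ptLip hβ
  have hγc := ptLip hγ
  obtain ⟨N1, hN1⟩ := ptBound hKc hαc (R + 2)
  obtain ⟨N2, hN2⟩ := ptBound hKc hβc (R + 2)
  obtain ⟨N3, hN3⟩ := ptBound hKc hγc (R + 2)
  set N : ℝ := max 1 (max N1 (max N2 N3)) with hN
  have hNp : 1 ≤ N := le_max_left _ _
  have hbd : ∀ ξ ∈ K, ∀ s, |s| ≤ R + 2 → |α ξ s| ≤ N ∧ |β ξ s| ≤ N ∧ |γ ξ s| ≤ N := by
    intro ξ hξ s hs
    refine ⟨(hN1 ξ hξ s hs).trans ?_, (hN2 ξ hξ s hs).trans ?_, (hN3 ξ hξ s hs).trans ?_⟩ <;>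
      simp [hN]
  obtain ⟨τ, β₀, hτ, hβ₀, hsg, hcase⟩ := ptStruct hstruct
  set κ : ℝ := 3 * (N + 1) with hκ
  have hκp : 0 < κ := by positivity
  have hfrK : frontier Ω ⊆ K := frontier_subset_closure
  obtain ⟨ρB, hρB, δB, hδB, hB⟩ := ptComp (hKc.of_isClosed_subset isClosed_frontier hfrK) hfrK
    hvu hwl (d := 0) (fun ξ hξ => ptFactB (hbdry ξ hξ))
  have hδB : 0 < δB := hδB
  set l : ℝ := min (1 / (2 * κ)) (δB / 4) with hl
  have hlp : 0 < l := by positivity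
  have hlδ : l ≤ δB / 4 := min_le_right _ _
  have hlk : l * κ ≤ 1 / 2 := by
    have : l ≤ 1 / (2 * κ) := min_le_left _ _
    rw [le_div_iff₀ (by positivity)] at this
    linarith
  have hl1 : l ≤ 1 := by
    have : 1 ≤ κ := by rw [hκ]; linarith
    nlinarith
  obtain ⟨g, g1, g2, G, hgc, hgd, hg1d, hgm, hGm, hGc, hgG, hGg, hgle, μ0, hμ0, hμ⟩ :=
    ptG (R := R) hκp hlp hlk hτ
  obtain ⟨C, hCp, ρL, hρL, hLd⟩ := ptLdiff hKc hαc hβc hγc hmono hNp hbd hμ0 hcase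
  obtain ⟨ρA, hρA, δA, hδA, hA⟩ := ptComp hKc subset_rfl hvu hwl (d := -ρL)
    (fun ξ hξ => ptFactA (hvt ξ hξ) (hwb ξ hξ) (hvw ξ hξ) hρL)
  obtain ⟨t1, ht1, hs1⟩ := ptSmall (2 * n * RK ^ 2) one_pos
  obtain ⟨t2, ht2, hs2⟩ := ptSmall (2 * n * RK ^ 2) (b := δB / 4) (by positivity)
  obtain ⟨t3, ht3, hs3⟩ := ptSmall (C * (2 * n * (2 * RK + 1) ^ 2)) (b := 1 / 2) (by positivity)
  set θ : ℝ := min t1 (min t2 t3) with hθ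
  have hθp : 0 < θ := by positivity
  have hθ1 := hs1 θ hθp.le (min_le_left _ _)
  have hθ2 := hs2 θ hθp.le ((min_le_right _ _).trans (min_le_left _ _))
  have hθ3 := hs3 θ hθp.le ((min_le_right _ _).trans (min_le_right _ _))
  have hθz : ∀ ξ ∈ K, 0 ≤ θ * zsq ξ ∧ θ * zsq ξ ≤ 1 ∧ θ * zsq ξ ≤ δB / 4 := by
    intro ξ hξ
    have h1 : zsq ξ ≤ 2 * n * RK ^ 2 := by
      refine (zsq_le ξ).trans ?_
      have := hRK ξ hξ
      gcongr
    have h2 := mul_le_mul_of_nonneg_left h1 hθp.le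
    exact ⟨mul_nonneg hθp.le (zsq_nonneg' ξ), h2.trans hθ1, h2.trans hθ2⟩
  obtain ⟨ε, hε, e1, e2, e3, e4, e5, e6⟩ : ∃ ε > 0, ε ≤ θ ∧ ε ≤ 1 ∧ ε ≤ ρL ∧ ε ≤ ρA ∧ ε ≤ ρB ∧
      ε ≤ δB / 4 := by
    refine ⟨min θ (min 1 (min ρL (min ρA (min ρB (δB / 4))))), by positivity, ?_⟩
    simp
  set Ku : Set (Heis n) := K ∩ v ⁻¹' Set.Ici ((-R - 2 : ℝ) : EReal) with hKu
  set Kw : Set (Heis n) := K ∩ w ⁻¹' Set.Iic ((R + 3 : ℝ) : EReal) with hKw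
  have hKuc : IsCompact Ku := hvu.isCompact_inter_preimage_Ici hKc _
  have hKwc : IsCompact Kw := hwl.isCompact_inter_preimage_Iic hKc _
  have hvr : ∀ ξ ∈ Ku, v ξ = (((v ξ).toReal : ℝ) : EReal) := by
    intro ξ hξ
    refine (EReal.coe_toReal (hvt ξ hξ.1) ?_).symm
    exact ((EReal.bot_lt_coe _).trans_le hξ.2).ne'
  have hwr : ∀ ξ ∈ Kw, w ξ = (((w ξ).toReal : ℝ) : EReal) := by
    intro ξ hξ
    refine (EReal.coe_toReal ?_ (hwb ξ hξ.1)).symm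
    exact (lt_of_le_of_lt hξ.2 (EReal.coe_lt_top _)).ne
  have hr1 : r0 ≤ C1 := by
    have := hC1 ξ0 (hΩK hξ0)
    rwa [hr0, EReal.coe_le_coe_iff] at this
  have hr2 : -C2 ≤ r0 := by
    have := hC2 ξ0 (hΩK hξ0)
    rwa [hr0w, EReal.coe_le_coe_iff] at this
  have h0u : ξ0 ∈ Ku := by
    refine ⟨hΩK hξ0, ?_⟩
    rw [Set.mem_preimage, hr0, Set.mem_Ici, EReal.coe_le_coe_iff]; linarith
  have h0w : ξ0 ∈ Kw := by
    refine ⟨hΩK hξ0, ?_⟩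
    rw [Set.mem_preimage, hr0w, Set.mem_Iic, EReal.coe_le_coe_iff]; linarith
  have huv : UpperSemicontinuousOn (fun ξ => (v ξ).toReal) Ku := by
    intro ξ hξ y hy
    have h1 : v ξ < (y : EReal) := by
      rw [hvr ξ hξ, EReal.coe_lt_coe_iff]; exact hy
    have h2 : ∀ᶠ x in 𝓝[Ku] ξ, v x < (y : EReal) :=
      (hvu.mono Set.inter_subset_left) ξ hξ _ h1
    filter_upwards [h2, self_mem_nhdsWithin] with x hx hxK
    rwa [hvr x hxK, EReal.coe_lt_coe_iff] at hx
  have hu1 : UpperSemicontinuousOn (fun ξ => G (v ξ).toReal + θ * zsq ξ) Ku := by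
    refine UpperSemicontinuousOn.add (f := fun ξ => G (v ξ).toReal)
      (hGc.comp_upperSemicontinuousOn huv hGm.monotone) ?_
    apply ContinuousOn.upperSemicontinuousOn
    apply Continuous.continuousOn
    unfold zsq
    fun_prop
  have hu2 : UpperSemicontinuousOn (fun ξ => -(w ξ).toReal) Kw := by
    intro ξ hξ y hy
    have h1 : ((-y : ℝ) : EReal) < w ξ := by
      rw [hwr ξ hξ, EReal.coe_lt_coe_iff]
      have hy' : -(w ξ).toReal < y := hy
      linarith
    have h2 : ∀ᶠ x in 𝓝[Kw] ξ, ((-y : ℝ) : EReal) < w x :=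
      (hwl.mono Set.inter_subset_left) ξ hξ _ h1
    filter_upwards [h2, self_mem_nhdsWithin] with x hx hxK
    rw [hwr x hxK, EReal.coe_lt_coe_iff] at hx
    linarith
  obtain ⟨η, hηu, ζ, hζw, hd, hmax, p, q, A, B, hAs, hBs, hj1, hj2, hpq, hAB⟩ :=
    ptDoubling hKuc hKwc hu1 hu2 h0u h0w hε
  have hηK : η ∈ K := hηu.1
  have hζK : ζ ∈ K := hζw.1
  obtain ⟨s, hs⟩ : ∃ s, s = (v η).toReal := ⟨_, rfl⟩
  obtain ⟨s', hs'⟩ : ∃ s', s' = (w ζ).toReal := ⟨_, rfl⟩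
  have hvs : v η = (s : EReal) := by rw [hs]; exact hvr η hηu
  have hws : w ζ = (s' : EReal) := by rw [hs']; exact hwr ζ hζw
  obtain ⟨c, hc⟩ : ∃ c, c = G s := ⟨_, rfl⟩
  have hgcs : g c = s := by rw [hc, hgG]
  have hGr : r0 ≤ G r0 := by
    have := hGm.monotone (hgle r0)
    rwa [hGg] at this
  have hs'c : s' ≤ c + θ * zsq η + ε := by
    simp only [hr0, hr0w, EReal.toReal_coe, ← hs, ← hs', ← hc] at hmax
    linarith [(hθz ξ0 (hΩK hξ0)).1]
  have hsC : s ≤ C1 := by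
    have := hC1 η hηK
    rwa [hvs, EReal.coe_le_coe_iff] at this
  have hs'C : -C2 ≤ s' := by
    have := hC2 ζ hζK
    rwa [hws, EReal.coe_le_coe_iff] at this
  obtain ⟨hz0, hz1, hz2⟩ := hθz η hηK
  have hRp : 0 < R := by rw [hR]; linarith
  have hcR : |c| ≤ R := by
    rw [abs_le]
    constructor
    · linarith
    · obtain ⟨-, -, -, -, -, hgR⟩ := hμ R (abs_of_pos hRp).le
      have : G s ≤ G (g R) := hGm.monotone (by linarith)
      rwa [hGg, ← hc] at this
  obtain ⟨μ, hμ1, hμ2, hμ3, hμ4, hcl⟩ := hμ c hcR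
  obtain ⟨hcR1, hcR2⟩ := abs_le.1 hcR
  have hηΩ : η ∈ Ω := by
    by_contra h
    have := hB η (hKΩ η hηK h) η hηK ζ hζK (by rw [dist_self]; exact hρB)
      (by rw [dist_comm]; linarith) s s' hvs hws
    linarith
  have hζΩ : ζ ∈ Ω := by
    by_contra h
    have := hB ζ (hKΩ ζ hζK h) η hηK ζ hζK (by linarith)
      (by rw [dist_self]; exact hρB) s s' hvs hws
    linarith
  have hss : s ≤ s' + ρL := by
    have := hA η hηK η hηK ζ hζK (by rw [dist_self]; exact hρA)
      (by rw [dist_comm]; linarith) s s' hvs hws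
    linarith
  have hsR : |s| ≤ R + 2 := by
    rw [abs_le]; constructor <;> linarith
  have hs'R : |s'| ≤ R + 2 := by
    rw [abs_le]; constructor <;> linarith
  have hg1p : 0 < g1 c := by
    rw [hμ3]
    rcases hτ with h | h <;> rw [h] <;> linarith
  have hle1 : ∀ᶠ h in 𝓝 (0 : Heis n), η + h ∈ Ω →
      v (η + h) ≤ ((g (c + θ * zsq η + p h + (1 / 2) * A h h - θ * zsq (η + h)) : ℝ) : EReal) := by
    have hcont : Continuous fun h : Heis n =>
        g (c + θ * zsq η + p h + (1 / 2) * A h h - θ * zsq (η + h)) := by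
      apply hgc.continuous.comp
      unfold zsq
      fun_prop
    have hev : ∀ᶠ h in 𝓝 (0 : Heis n),
        -R - 2 < g (c + θ * zsq η + p h + (1 / 2) * A h h - θ * zsq (η + h)) := by
      apply hcont.continuousAt.eventually
      apply lt_mem_nhds
      simp only [map_zero, mul_zero, add_zero, add_sub_cancel_right]
      linarith
    filter_upwards [hj1, hev] with h h1 h2 hΩ'
    by_cases hu : η + h ∈ Ku
    · have h3 := h1 hu
      simp only [← hs, ← hc] at h3
      rw [hvr _ hu, EReal.coe_le_coe_iff, ← hgG (v (η + h)).toReal]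
      apply hgm.monotone
      linarith
    · have h3 : v (η + h) < ((-R - 2 : ℝ) : EReal) := by
        by_contra h4
        exact hu ⟨hΩK hΩ', not_lt.1 h4⟩
      exact h3.le.trans (EReal.coe_le_coe_iff.2 h2.le)
  have hle2 : ∀ᶠ h in 𝓝 (0 : Heis n), ζ + h ∈ Ω →
      (((s' - q h - (1 / 2) * B h h : ℝ)) : EReal) ≤ w (ζ + h) := by
    have hcont : Continuous fun h : Heis n => s' - q h - (1 / 2) * B h h := by
      fun_prop
    have hev : ∀ᶠ h in 𝓝 (0 : Heis n), s' - q h - (1 / 2) * B h h < R + 3 := by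
      refine hcont.continuousAt.eventually (p := fun y => y < R + 3) ?_
      apply gt_mem_nhds
      simp only [map_zero, mul_zero, sub_zero]
      linarith [(abs_le.1 hs'R).2]
    filter_upwards [hj2, hev] with h h1 h2 hΩ'
    by_cases hu : ζ + h ∈ Kw
    · have h3 := h1 hu
      simp only [← hs'] at h3
      rw [hwr _ hu, EReal.coe_le_coe_iff]
      linarith
    · have h3 : ((R + 3 : ℝ) : EReal) < w (ζ + h) := by
        by_contra h4
        exact hu ⟨hΩK hΩ', not_lt.1 h4⟩
      exact le_trans (EReal.coe_le_coe_iff.2 h2.le) h3.le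
  have hL := hLd η hηK ζ hζK s s' hsR hs'R (by linarith) hss
  have hsgn := hsg η hηK s
  have hbb := (hbd η hηK s hsR).1
  rw [← hgcs] at hL hsgn hbb hvs
  exact ptCore hSsymm hSpos hScone hwsuper hvsub hηΩ hζΩ hgc hgd (hg1d c) hg1p hvs hws hAs hBs
    hθp hle1 hle2 hpq hAB hμ0 hμ1 hτ hbb hsgn.1 hsgn.2 hβ₀ hκ hμ4 hμ3 e1 hCp (hRK η hηK) hθ3 hL
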